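/- The function C attains its minimum on [0,10], and every minimizer is transcendental: for every s* ∈ [0,10] with C(s*) ≤ C(s) for all s ∈ [0,10], the real number s* is not a root of any nonzero polynomial with rational coefficients. -/

import Mathlib

/-- The cost `C(s)` (under the Euclidean 2-norm) of the optimal monotone matching
candidate `γ_s` for the curves `P = ⟨(4,−2),(1,2),(1,−4)⟩`, `Q = ⟨(0,0),(5,0)⟩`
whose parameter-space path follows the first cell's valley up to `ℓ¹`-parameter `s`. -/
noncomputable def C (s : ℝ) : ℝ :=
  2 / Real.sqrt 5 * (∫ t in (0:ℝ)..s, |t - 5|)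
  + 1 / Real.sqrt 2 * (∫ t in (s + 6)..(16:ℝ), |t - 8|)
  + (∫ t in s..(s / 2 + 5), Real.sqrt (t ^ 2 - (2 * s / 5 + 8) * t + (s ^ 2 / 5 + 20)))
  + (∫ t in (s / 2 + 5)..(s + 6),
      Real.sqrt (t ^ 2 - (s + 14) * t + (s ^ 2 / 2 + 6 * s + 50)))

open scoped Polynomial

/-- The operator `p ↦ a • p(X + 1) - b • p`. -/
noncomputable def shiftOp {F : Type*} [Field F] (a b : F) (p : F[X]) : F[X] :=
  Polynomial.C a * p.comp (Polynomial.X + 1) - Polynomial.C b * p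

lemma shiftOp_eval {F : Type*} [Field F] (a b x : F) (p : F[X]) :
    (shiftOp a b p).eval x = a * p.eval (x + 1) - b * p.eval x := by
  simp [shiftOp]

lemma degree_comp_X_add_one {F : Type*} [Field F] (p : F[X]) :
    (p.comp (Polynomial.X + 1)).degree = p.degree := by
  have h := Polynomial.degree_taylor p (1 : F)
  rwa [Polynomial.taylor_apply, Polynomial.C_1] at h

lemma leadingCoeff_comp_X_add_one {F : Type*} [Field F] (p : F[X]) :
    (p.comp (Polynomial.X + 1)).leadingCoeff = p.leadingCoeff := by
  have := Polynomial.leadingCoeff_comp (p := p) (q := Polynomial.X + Polynomial.C (1 : F)) (by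
    rw [Polynomial.natDegree_X_add_C]; exact one_ne_zero)
  rw [Polynomial.leadingCoeff_X_add_C, one_pow, mul_one] at this
  simpa only [Polynomial.C_1] using this

lemma shiftOp_degree_lt {F : Type*} [Field F] (a b : F) {p : F[X]} {k : ℕ}
    (hp : p.degree < k) : (shiftOp a b p).degree < k := by
  have h (c : F) (q : F[X]) (hq : q.degree < k) : (Polynomial.C c * q).degree < k :=
    by
    rcases eq_or_ne c 0 with rfl | hc
    · simp
    · rwa [Polynomial.degree_C_mul hc]
  refine lt_of_le_of_lt (Polynomial.degree_sub_le _ _) (max_lt (h _ _ ?_) (h _ _ hp))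
  rwa [degree_comp_X_add_one]

lemma shiftOp_self_degree_lt {F : Type*} [Field F] {a : F} (ha : a ≠ 0) {p : F[X]} {k : ℕ}
    (hp : p.degree < (k + 1 : ℕ)) : (shiftOp a a p).degree < k := by
  by_cases hp0 : p = 0
  · simp [hp0, shiftOp]
  have h1 : (shiftOp a a p).degree < (Polynomial.C a * p).degree := by
    have e : (Polynomial.C a * p.comp (Polynomial.X + 1)).degree = (Polynomial.C a * p).degree := by
      rw [Polynomial.degree_C_mul ha, Polynomial.degree_C_mul ha, degree_comp_X_add_one]
    refine (Polynomial.degree_sub_lt_left e ?_ ?_).trans_eq e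
    · rw [Ne, mul_eq_zero, ← Polynomial.leadingCoeff_eq_zero (p := p.comp _),
        leadingCoeff_comp_X_add_one]
      simp [ha, hp0]
    · simp [Polynomial.leadingCoeff_mul, leadingCoeff_comp_X_add_one]
  rw [Polynomial.degree_C_mul ha, Polynomial.degree_eq_natDegree hp0] at h1
  rw [Polynomial.degree_eq_natDegree hp0] at hp
  have : p.natDegree ≤ k := Nat.lt_succ_iff.1 (by exact_mod_cast hp)
  exact h1.trans_le (by exact_mod_cast this)

lemma shiftOp_eq_zero {F : Type*} [Field F] {a b : F} (hab : a ≠ b) {p : F[X]}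
    (h : shiftOp a b p = 0) : p = 0 := by
  have e : Polynomial.C a * p.comp (Polynomial.X + 1) = Polynomial.C b * p := sub_eq_zero.1 h
  have := congrArg Polynomial.leadingCoeff e
  rw [Polynomial.leadingCoeff_mul, Polynomial.leadingCoeff_mul, Polynomial.leadingCoeff_C,
    Polynomial.leadingCoeff_C,
    leadingCoeff_comp_X_add_one] at this
  by_contra hp
  exact hab (mul_right_cancel₀ (Polynomial.leadingCoeff_ne_zero.2 hp) this)

lemma shiftOp_iterate_self {F : Type*} [Field F] {a : F} (ha : a ≠ 0) (k : ℕ) {p : F[X]}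
    (hp : p.degree < k) : (shiftOp a a)^[k] p = 0 := by
  induction k generalizing p with
  | zero => simpa using hp
  | succ k ih => exact ih (shiftOp_self_degree_lt ha hp)

lemma shiftOp_iterate_degree_lt {F : Type*} [Field F] (a b : F) {k : ℕ} (n : ℕ) {p : F[X]}
    (hp : p.degree < k) : ((shiftOp a b)^[n] p).degree < k := by
  induction n generalizing p with
  | zero => simpa using hp
  | succ n ih => exact ih (shiftOp_degree_lt a b hp)

lemma shiftOp_iterate_eq_zero {F : Type*} [Field F] {a b : F} (hab : a ≠ b) (n : ℕ) {p : F[X]}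
    (h : (shiftOp a b)^[n] p = 0) : p = 0 := by
  induction n generalizing p with
  | zero => simpa using h
  | succ n ih => exact shiftOp_eq_zero hab (ih h)

lemma sum_shiftOp_iterate_eq_zero {F : Type*} [Field F] (S : Finset F) (b : F) (n : ℕ) :
    ∀ (q : F → F[X]) (N : ℕ),
      (∀ l < N + n, ∑ w ∈ S, (q w).eval (l : F) * w ^ l = 0) →
      ∀ l < N, ∑ w ∈ S, ((shiftOp w b)^[n] (q w)).eval (l : F) * w ^ l = 0 := by
  induction n with
  | zero => intro q N h; simpa using h
  | succ n ih =>
    intro q N h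
    refine ih (fun w => shiftOp w b (q w)) N fun l hl => ?_
    have h1 := h (l + 1) (by omega)
    have h0 := h l (by omega)
    calc _ = ∑ w ∈ S, (q w).eval ((l + 1 : ℕ) : F) * w ^ (l + 1)
          - b * ∑ w ∈ S, (q w).eval (l : F) * w ^ l := by
            rw [Finset.mul_sum, ← Finset.sum_sub_distrib]
            refine Finset.sum_congr rfl fun w _ => ?_
            rw [shiftOp_eval]; push_cast; ring
      _ = 0 := by rw [h1, h0]; ring

/-- An exponential polynomial with distinct nonzero bases and coefficients of degree `< k` that
vanishes at `k * #S` consecutive integers is zero. -/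
theorem exponentialPolynomial_eq_zero {F : Type*} [Field F] [CharZero F] (k : ℕ) (S : Finset F) :
    ∀ q : F → F[X], (∀ w ∈ S, w ≠ 0) → (∀ w ∈ S, (q w).degree < k) →
      (∀ l < k * S.card, ∑ w ∈ S, (q w).eval (l : F) * w ^ l = 0) → ∀ w ∈ S, q w = 0 := by
  classical
  induction S using Finset.induction_on with
  | empty => simp
  | insert b S hb ih =>
    intro q h0 hdeg hz
    rw [Finset.card_insert_of_notMem hb, mul_add_one] at hz
    have hb0 : b ≠ 0 := h0 b (Finset.mem_insert_self _ _)
    have hS : ∀ w ∈ S, q w = 0 := by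
      intro w hw
      have hwb : w ≠ b := fun e => hb (e ▸ hw)
      refine shiftOp_iterate_eq_zero hwb k ?_
      refine ih (fun w => (shiftOp w b)^[k] (q w)) (fun w hw => h0 w (Finset.mem_insert_of_mem hw))
        (fun w hw => shiftOp_iterate_degree_lt _ _ _ (hdeg w (Finset.mem_insert_of_mem hw)))
        (fun l hl => ?_) w hw
      have := sum_shiftOp_iterate_eq_zero (insert b S) b k q _ hz l hl
      rwa [Finset.sum_insert hb, shiftOp_iterate_self hb0 k (hdeg b (Finset.mem_insert_self _ _)),
        Polynomial.eval_zero, zero_mul, zero_add] at this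
    have hq : q b = 0 := by
      have hev : ∀ l < k, (q b).eval (l : F) = 0 := by
        intro l hl
        have := hz l (by omega)
        rw [Finset.sum_insert hb, Finset.sum_eq_zero (fun w hw => by rw [hS w hw]; simp),
          add_zero] at this
        exact (mul_eq_zero.1 this).resolve_right (pow_ne_zero _ hb0)
      refine Polynomial.eq_zero_of_degree_lt_of_eval_finset_eq_zero
        ((Finset.range k).image (fun l : ℕ => (l : F))) ?_ ?_
      · rw [Finset.card_image_of_injective _ Nat.cast_injective, Finset.card_range]
        exact hdeg b (Finset.mem_insert_self _ _)
      · intro x hx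
        obtain ⟨l, hl, rfl⟩ := Finset.mem_image.1 hx
        exact hev l (Finset.mem_range.1 hl)
    intro w hw
    rcases Finset.mem_insert.1 hw with rfl | hw
    · exact hq
    · exact hS w hw

lemma exists_eq_pow_mul_of_le_analyticOrderAt (a : ℂ) (T : ℕ) :
    ∀ f : ℂ → ℂ, Differentiable ℂ f → (T : ℕ∞) ≤ analyticOrderAt f a →
      ∃ g : ℂ → ℂ, Differentiable ℂ g ∧ f = fun z => (z - a) ^ T * g z := by
  induction T with
  | zero => intro f hf _; exact ⟨f, hf, by simp⟩
  | succ T ih =>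
    intro f hf h
    have hfa : f a = 0 := by
      refine apply_eq_zero_of_analyticOrderAt_ne_zero fun h0 => ?_
      rw [h0] at h
      exact absurd h (by simp)
    have hd : Differentiable ℂ (dslope f a) := by
      rw [← differentiableOn_univ]
      exact (Complex.differentiableOn_dslope Filter.univ_mem).2 hf.differentiableOn
    have he : f = fun z => (z - a) * dslope f a z := by
      funext z
      have := sub_smul_dslope f a z
      rw [hfa, sub_zero, smul_eq_mul] at this
      exact this.symm
    have ho : analyticOrderAt f a = 1 + analyticOrderAt (dslope f a) a := by
      conv_lhs => rw [he]
      have := analyticOrderAt_mul (f := fun z : ℂ => z - a) (g := dslope f a) (z₀ := a)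
        (by fun_prop) (hd.analyticAt a)
      rw [show analyticOrderAt (fun z : ℂ => z - a) a = 1 from
        analyticOrderAt_id_sub_const_self] at this
      exact this
    rw [ho, add_comm 1] at h
    push_cast at h
    obtain ⟨g, hg, hgf⟩ := ih (dslope f a) hd ((ENat.add_le_add_iff_right ENat.one_ne_top).1 h)
    refine ⟨g, hg, ?_⟩
    rw [he, hgf]
    funext z
    ring

lemma exists_eq_prod_mul_of_le_analyticOrderAt (S : Finset ℂ) (T : ℕ) :
    ∀ f : ℂ → ℂ, Differentiable ℂ f → (∀ a ∈ S, (T : ℕ∞) ≤ analyticOrderAt f a) →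
      ∃ g : ℂ → ℂ, Differentiable ℂ g ∧ f = fun z => (∏ a ∈ S, (z - a) ^ T) * g z := by
  classical
  induction S using Finset.induction_on with
  | empty => intro f hf _; exact ⟨f, hf, by simp⟩
  | insert a S ha ih =>
    intro f hf h
    obtain ⟨g, hg, hfg⟩ := exists_eq_pow_mul_of_le_analyticOrderAt a T f hf
      (h a (Finset.mem_insert_self _ _))
    have hord : ∀ b ∈ S, (T : ℕ∞) ≤ analyticOrderAt g b := by
      intro b hb
      have hba : b ≠ a := fun e => ha (e ▸ hb)
      have h1 := h b (Finset.mem_insert_of_mem hb)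
      have h2 := analyticOrderAt_mul (f := fun z : ℂ => (z - a) ^ T) (g := g) (z₀ := b)
        (by fun_prop) (hg.analyticAt b)
      have h3 : analyticOrderAt (fun z : ℂ => (z - a) ^ T) b = 0 :=
        analyticOrderAt_eq_zero.2 (Or.inr (pow_ne_zero _ (sub_ne_zero.2 hba)))
      rw [h3, zero_add] at h2
      rw [← h2]
      rwa [hfg] at h1
    obtain ⟨k, hk, hgk⟩ := ih g hg hord
    refine ⟨k, hk, ?_⟩
    rw [hfg, hgk]
    funext z
    rw [Finset.prod_insert ha]
    ring

/-- Schwarz lemma for an entire function with zeros of order `T` at `0, 1, …, h - 1`. -/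
theorem norm_mul_pow_le_of_le_analyticOrderAt {f : ℂ → ℂ} (hf : Differentiable ℂ f) {h T : ℕ}
    (hord : ∀ l < h, (T : ℕ∞) ≤ analyticOrderAt f (l : ℂ)) {r q B : ℝ} (hhr : (h : ℝ) ≤ r)
    (hr : 0 < r) (hq : 1 ≤ q) (hB : ∀ z : ℂ, ‖z‖ = 2 * q * r → ‖f z‖ ≤ B)
    {w : ℕ} (hw : (w : ℝ) ≤ r) :
    ‖f w‖ * q ^ (T * h) ≤ B := by
  obtain ⟨g, hg, hfg⟩ := exists_eq_prod_mul_of_le_analyticOrderAt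
    ((Finset.range h).image (fun l : ℕ => (l : ℂ))) T f hf (by
      intro a ha
      obtain ⟨l, hl, rfl⟩ := Finset.mem_image.1 ha
      exact hord l (Finset.mem_range.1 hl))
  have hprod : ∀ z : ℂ, f z = (∏ l ∈ Finset.range h, (z - l) ^ T) * g z := by
    intro z
    rw [congrFun hfg z, Finset.prod_image (fun x _ y _ e => Nat.cast_injective e)]
  have hq0 : 0 < q := by linarith
  have hqr : 0 < q * r := mul_pos hq0 hr
  have hB0 : 0 ≤ B := le_trans (norm_nonneg _) (hB ((2 * q * r : ℝ) : ℂ) (by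
    rw [Complex.norm_real, Real.norm_of_nonneg (by nlinarith)]))
  have hgB : ‖g w‖ ≤ B / (q * r) ^ (T * h) := by
    refine Complex.norm_le_of_forall_mem_frontier_norm_le (U := Metric.ball (0 : ℂ) (2 * q * r))
      Metric.isBounded_ball hg.diffContOnCl ?_ (subset_closure ?_)
    · intro z hz
      rw [frontier_ball _ (by nlinarith), mem_sphere_zero_iff_norm] at hz
      rw [le_div_iff₀ (pow_pos hqr _)]
      have hlow : (q * r) ^ (T * h) ≤ ‖∏ l ∈ Finset.range h, (z - (l : ℂ)) ^ T‖ := by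
        rw [norm_prod, pow_mul]
        calc _ = ∏ l ∈ Finset.range h, (q * r) ^ T := by simp
          _ ≤ _ := by
            refine Finset.prod_le_prod (fun _ _ => by positivity) fun l hl => ?_
            rw [norm_pow]
            refine pow_le_pow_left₀ hqr.le ?_ _
            have h1 := norm_sub_norm_le z (l : ℂ)
            have h2 : (l : ℝ) ≤ h := by exact_mod_cast (Finset.mem_range.1 hl).le
            rw [hz, Complex.norm_natCast] at h1
            nlinarith
      calc ‖g z‖ * (q * r) ^ (T * h) ≤ ‖g z‖ * ‖∏ l ∈ Finset.range h, (z - (l : ℂ)) ^ T‖ := by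
            gcongr
        _ = ‖f z‖ := by rw [hprod z, norm_mul, mul_comm]
        _ ≤ B := hB z hz
    · rw [mem_ball_zero_iff, Complex.norm_natCast]
      nlinarith
  have hup : ‖∏ l ∈ Finset.range h, ((w : ℂ) - (l : ℂ)) ^ T‖ ≤ r ^ (T * h) := by
    rw [norm_prod, pow_mul]
    calc _ ≤ ∏ l ∈ Finset.range h, r ^ T := by
            refine Finset.prod_le_prod (fun _ _ => norm_nonneg _) fun l hl => ?_
            rw [norm_pow]
            refine pow_le_pow_left₀ (norm_nonneg _) ?_ _
            have h2 : (l : ℝ) ≤ h := by exact_mod_cast (Finset.mem_range.1 hl).le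
            have h3 : ‖(w : ℂ) - (l : ℂ)‖ = |(w : ℝ) - l| := by
              rw [← Real.norm_eq_abs, ← Complex.norm_real]; push_cast; rfl
            rw [h3, abs_le]
            constructor <;> linarith [Nat.cast_nonneg (α := ℝ) w, Nat.cast_nonneg (α := ℝ) l]
      _ = _ := by simp
  calc ‖f w‖ * q ^ (T * h) ≤ r ^ (T * h) * (B / (q * r) ^ (T * h)) * q ^ (T * h) := by
        rw [hprod w, norm_mul]; gcongr
    _ = B := by
        rw [mul_pow]; field_simp

/-- The value at `z` of `(d/dz + a)^m` applied to the monomial `z ^ i`. -/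
def auxPoly {R : Type*} [CommRing R] (a z : R) : ℕ → ℕ → R
  | 0, i => z ^ i
  | m + 1, i => i * auxPoly a z m (i - 1) + a * auxPoly a z m i

lemma map_auxPoly {R S : Type*} [CommRing R] [CommRing S] (φ : R →+* S) (a z : R) (m i : ℕ) :
    φ (auxPoly a z m i) = auxPoly (φ a) (φ z) m i := by
  induction m generalizing i with
  | zero => simp [auxPoly]
  | succ m ih => simp [auxPoly, ih]

lemma norm_auxPoly_le {a z : ℂ} {A ρ : ℝ} (hρ : 1 ≤ ρ) (hz : ‖z‖ ≤ ρ) (m : ℕ) :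
    ∀ i : ℕ, i + ‖a‖ ≤ A → ‖auxPoly a z m i‖ ≤ A ^ m * ρ ^ i := by
  induction m with
  | zero =>
    intro i _
    simpa [auxPoly] using pow_le_pow_left₀ (norm_nonneg z) hz i
  | succ m ih =>
    intro i hi
    have h1 := ih i hi
    have h2 : ‖auxPoly a z m (i - 1)‖ ≤ A ^ m * ρ ^ i := by
      have hA : 0 ≤ A := le_trans (by positivity) hi
      refine (ih (i - 1) (le_trans ?_ hi)).trans ?_
      · gcongr; omega
      · gcongr
        omega
    have hA : 0 ≤ A := le_trans (by positivity) hi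
    calc ‖auxPoly a z (m + 1) i‖
        ≤ i * ‖auxPoly a z m (i - 1)‖ + ‖a‖ * ‖auxPoly a z m i‖ := by
          refine (norm_add_le _ _).trans ?_
          rw [norm_mul, norm_mul, Complex.norm_natCast]
      _ ≤ i * (A ^ m * ρ ^ i) + ‖a‖ * (A ^ m * ρ ^ i) := by gcongr
      _ = (i + ‖a‖) * (A ^ m * ρ ^ i) := by ring
      _ ≤ A * (A ^ m * ρ ^ i) := by gcongr
      _ = _ := by ring

lemma hasDerivAt_auxPoly (a z : ℂ) (m i : ℕ) :
    HasDerivAt (fun z => auxPoly a z m i) (i * auxPoly a z m (i - 1)) z := by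
  induction m generalizing i with
  | zero => simpa [auxPoly] using hasDerivAt_pow i z
  | succ m ih =>
    have := ((ih (i - 1)).const_mul (i : ℂ)).add ((ih i).const_mul a)
    refine this.congr_deriv ?_
    simp only [auxPoly]
    ring

/-- The algebraic factor of the `(m₀, m₁)`-th normalised partial derivative of
`z₀ ^ i * exp (k b₀ z₀) * exp ((j + k b₁) z₁ log γ)`. -/
def auxTerm {R : Type*} [CommRing R] (b₀ b₁ z : R) (m₀ m₁ i j k : ℕ) : R :=
  auxPoly (k * b₀) z m₀ i * (j + k * b₁) ^ m₁

/-- The integral multiple of the value of an auxiliary term at the integer point `l`. -/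
def auxVal {R : Type*} [CommRing R] (b₀ b₁ G₁ G₂ d : R) (L l m₀ m₁ i j k : ℕ) : R :=
  auxTerm b₀ b₁ l m₀ m₁ i j k *
    (G₁ ^ (j * l) * d ^ ((L - j) * l) * (G₂ ^ (k * l) * d ^ ((L - k) * l)))

lemma map_auxVal {R S : Type*} [CommRing R] [CommRing S] (φ : R →+* S) (b₀ b₁ G₁ G₂ d : R)
    (L l m₀ m₁ i j k : ℕ) :
    φ (auxVal b₀ b₁ G₁ G₂ d L l m₀ m₁ i j k) =
      auxVal (φ b₀) (φ b₁) (φ G₁) (φ G₂) (φ d) L l m₀ m₁ i j k := by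
  simp [auxVal, auxTerm, map_auxPoly]

lemma norm_auxTerm_le {b₀ b₁ z : ℂ} {A ρ : ℝ} (hρ : 1 ≤ ρ) (hz : ‖z‖ ≤ ρ) {m₀ m₁ i j k : ℕ}
    (h₀ : i + k * ‖b₀‖ ≤ A) (h₁ : j + k * ‖b₁‖ ≤ A) :
    ‖auxTerm b₀ b₁ z m₀ m₁ i j k‖ ≤ A ^ (m₀ + m₁) * ρ ^ i := by
  have hA : 0 ≤ A := le_trans (by positivity) h₀
  rw [auxTerm, norm_mul, norm_pow, pow_add]
  have e₀ := norm_auxPoly_le (a := k * b₀) hρ hz m₀ i (by simpa using h₀)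
  have e₁ : ‖(j + k * b₁ : ℂ)‖ ≤ A := (norm_add_le _ _).trans (by simpa using h₁)
  calc _ ≤ A ^ m₀ * ρ ^ i * A ^ m₁ := by gcongr
    _ = _ := by ring

lemma norm_auxVal_le {b₀ b₁ G₁ G₂ d : ℂ} {A ρ β : ℝ} {L l m₀ m₁ i j k : ℕ} (hρ : 1 ≤ ρ)
    (hl : l ≤ ρ) (h₀ : i + k * ‖b₀‖ ≤ A) (h₁ : j + k * ‖b₁‖ ≤ A) (hG₁ : ‖G₁‖ ≤ β)
    (hG₂ : ‖G₂‖ ≤ β) (hd : ‖d‖ ≤ β) (hj : j ≤ L) (hk : k ≤ L) :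
    ‖auxVal b₀ b₁ G₁ G₂ d L l m₀ m₁ i j k‖ ≤ A ^ (m₀ + m₁) * ρ ^ i * β ^ (2 * L * l) := by
  have hA : 0 ≤ A := le_trans (by positivity) h₀
  have hβ : 0 ≤ β := (norm_nonneg _).trans hd
  have e := norm_auxTerm_le (z := l) (m₀ := m₀) (m₁ := m₁) hρ (by simpa using hl) h₀ h₁
  rw [auxVal, norm_mul]
  refine mul_le_mul e ?_ (norm_nonneg _) (by positivity)
  simp only [norm_mul, norm_pow]
  calc _ ≤ β ^ (j * l) * β ^ ((L - j) * l) * (β ^ (k * l) * β ^ ((L - k) * l)) := by gcongr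
    _ = β ^ (2 * L * l) := by
      rw [← pow_add, ← pow_add, ← pow_add, ← add_mul, ← add_mul, ← add_mul,
        Nat.add_sub_cancel' hj, Nat.add_sub_cancel' hk, two_mul]

/-- The auxiliary function with coefficients `c`, differentiated `m₀` and `m₁` times. -/
noncomputable def auxFun (b₀ b₁ ℓ₁ ℓ₂ : ℂ) {L₀ L : ℕ} (c : Fin L₀ × Fin L × Fin L → ℂ)
    (m₀ m₁ : ℕ) (z : ℂ) : ℂ :=
  ∑ x : Fin L₀ × Fin L × Fin L, c x * auxTerm b₀ b₁ z m₀ m₁ x.1 x.2.1 x.2.2 *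
    Complex.exp ((x.2.1 * ℓ₁ + x.2.2 * ℓ₂) * z)

section auxFun

variable {b₀ b₁ ℓ₁ ℓ₂ : ℂ} {L₀ L : ℕ} (c : Fin L₀ × Fin L × Fin L → ℂ)

lemma hasDerivAt_auxFun (hℓ : ℓ₂ = b₀ + b₁ * ℓ₁) (m₀ m₁ : ℕ) (z : ℂ) :
    HasDerivAt (auxFun b₀ b₁ ℓ₁ ℓ₂ c m₀ m₁)
      (auxFun b₀ b₁ ℓ₁ ℓ₂ c (m₀ + 1) m₁ z + ℓ₁ * auxFun b₀ b₁ ℓ₁ ℓ₂ c m₀ (m₁ + 1) z) z := by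
  unfold auxFun
  rw [Finset.mul_sum, ← Finset.sum_add_distrib]
  refine HasDerivAt.fun_sum fun x _ => ?_
  have h1 := ((hasDerivAt_auxPoly (x.2.2 * b₀) z m₀ x.1).mul_const
    (((x.2.1 : ℕ) + (x.2.2 : ℕ) * b₁) ^ m₁)).const_mul (c x)
  have h2 := ((hasDerivAt_id z).const_mul ((x.2.1 : ℕ) * ℓ₁ + (x.2.2 : ℕ) * ℓ₂)).cexp
  refine (h1.mul h2).congr_deriv ?_
  simp only [auxTerm, auxPoly, id, hℓ]
  ring

lemma differentiable_auxFun (hℓ : ℓ₂ = b₀ + b₁ * ℓ₁) (m₀ m₁ : ℕ) :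
    Differentiable ℂ (auxFun b₀ b₁ ℓ₁ ℓ₂ c m₀ m₁) :=
  fun z => (hasDerivAt_auxFun c hℓ m₀ m₁ z).differentiableAt

lemma le_analyticOrderAt_auxFun (hℓ : ℓ₂ = b₀ + b₁ * ℓ₁) {M : ℕ} {w : ℂ}
    (hz : ∀ m₀ < M, ∀ m₁ < M, auxFun b₀ b₁ ℓ₁ ℓ₂ c m₀ m₁ w = 0) (T : ℕ) :
    ∀ m₀ m₁, m₀ + T ≤ M → m₁ + T ≤ M →
      (T : ℕ∞) ≤ analyticOrderAt (auxFun b₀ b₁ ℓ₁ ℓ₂ c m₀ m₁) w := by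
  induction T with
  | zero => simp
  | succ T ih =>
    intro m₀ m₁ h₀ h₁
    have hd : deriv (auxFun b₀ b₁ ℓ₁ ℓ₂ c m₀ m₁) = auxFun b₀ b₁ ℓ₁ ℓ₂ c (m₀ + 1) m₁ +
        (fun _ => ℓ₁) * auxFun b₀ b₁ ℓ₁ ℓ₂ c m₀ (m₁ + 1) :=
      funext fun z => (hasDerivAt_auxFun c hℓ m₀ m₁ z).deriv
    push_cast
    rw [← analyticOrderAt_deriv_ge_iff ((differentiable_auxFun c hℓ m₀ m₁).analyticAt w)
      (hz _ (by omega) _ (by omega)), hd]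
    refine le_trans (le_min (ih _ _ (by omega) (by omega)) ?_) le_analyticOrderAt_add
    rw [analyticOrderAt_mul analyticAt_const
      ((differentiable_auxFun c hℓ m₀ (m₁ + 1)).analyticAt w)]
    exact (ih _ _ (by omega) (by omega)).trans le_add_self

lemma norm_auxFun_le {A ρ β P : ℝ} (hρ : 1 ≤ ρ) (hA : L₀ + L * ‖b₀‖ ≤ A)
    (hA' : L + L * ‖b₁‖ ≤ A) (hA1 : 1 ≤ A) (h₁ : ‖ℓ₁‖ ≤ β) (h₂ : ‖ℓ₂‖ ≤ β)
    (hP : ∀ x, ‖c x‖ ≤ P) {M m₀ m₁ : ℕ} (hm₀ : m₀ ≤ M) (hm₁ : m₁ ≤ M) {z : ℂ} (hz : ‖z‖ ≤ ρ) :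
    ‖auxFun b₀ b₁ ℓ₁ ℓ₂ c m₀ m₁ z‖ ≤
      (L₀ * (L * L) : ℕ) * (P * (A ^ (2 * M) * ρ ^ L₀) * Real.exp (2 * L * β * ρ)) := by
  have hcard : (L₀ * (L * L) : ℕ) = (Finset.univ : Finset (Fin L₀ × Fin L × Fin L)).card := by
    simp
  rw [hcard, ← nsmul_eq_mul]
  refine (norm_sum_le _ _).trans (Finset.sum_le_card_nsmul _ _ _ fun x _ => ?_)
  rw [norm_mul, norm_mul]
  have hx0 : ((x.1 : ℕ) : ℝ) ≤ L₀ := by exact_mod_cast x.1.2.le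
  have hx1 : ((x.2.1 : ℕ) : ℝ) ≤ L := by exact_mod_cast x.2.1.2.le
  have hx2 : ((x.2.2 : ℕ) : ℝ) ≤ L := by exact_mod_cast x.2.2.2.le
  have hP0 : 0 ≤ P := (norm_nonneg _).trans (hP x)
  have hβ0 : 0 ≤ β := (norm_nonneg _).trans h₁
  have e1 : ‖auxTerm b₀ b₁ z m₀ m₁ x.1 x.2.1 x.2.2‖ ≤ A ^ (2 * M) * ρ ^ L₀ := by
    refine (norm_auxTerm_le (A := A) hρ hz ?_ ?_).trans ?_
    · exact le_trans (by gcongr) hA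
    · exact le_trans (by gcongr) hA'
    · gcongr
      · omega
      · exact x.1.2.le
  have e2 : ‖Complex.exp ((x.2.1 * ℓ₁ + x.2.2 * ℓ₂) * z)‖ ≤ Real.exp (2 * L * β * ρ) := by
    refine (Complex.norm_exp_le_exp_norm _).trans (Real.exp_le_exp.2 ?_)
    rw [norm_mul]
    have : ‖(x.2.1 * ℓ₁ + x.2.2 * ℓ₂ : ℂ)‖ ≤ 2 * L * β := by
      refine (norm_add_le _ _).trans ?_
      rw [norm_mul, norm_mul, Complex.norm_natCast, Complex.norm_natCast]
      calc _ ≤ L * β + L * β := by gcongr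
        _ = _ := by ring
    gcongr
  gcongr
  exact hP x

lemma sum_auxVal_eq {G₁ G₂ d : ℂ} (hG₁ : G₁ = d * Complex.exp ℓ₁)
    (hG₂ : G₂ = d * Complex.exp ℓ₂) (m₀ m₁ l : ℕ) :
    ∑ x : Fin L₀ × Fin L × Fin L,
        c x * auxVal b₀ b₁ G₁ G₂ d L l m₀ m₁ x.1 x.2.1 x.2.2 =
      d ^ (2 * L * l) * auxFun b₀ b₁ ℓ₁ ℓ₂ c m₀ m₁ l := by
  rw [auxFun, Finset.mul_sum]
  refine Finset.sum_congr rfl fun x _ => ?_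
  have hj : (x.2.1 : ℕ) ≤ L := x.2.1.2.le
  have hk : (x.2.2 : ℕ) ≤ L := x.2.2.2.le
  have hd : d ^ (2 * L * l) = d ^ ((x.2.1 : ℕ) * l) * d ^ ((L - (x.2.1 : ℕ)) * l) *
      (d ^ ((x.2.2 : ℕ) * l) * d ^ ((L - (x.2.2 : ℕ)) * l)) := by
    rw [← pow_add, ← pow_add, ← pow_add, ← add_mul, ← add_mul, ← add_mul,
      Nat.add_sub_cancel' hj, Nat.add_sub_cancel' hk, two_mul]
  have he : Complex.exp ((x.2.1 * ℓ₁ + x.2.2 * ℓ₂) * l) =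
      Complex.exp ℓ₁ ^ ((x.2.1 : ℕ) * l) * Complex.exp ℓ₂ ^ ((x.2.2 : ℕ) * l) := by
    rw [← Complex.exp_nat_mul, ← Complex.exp_nat_mul, ← Complex.exp_add]
    congr 1
    push_cast
    ring
  rw [auxVal, hd, he, hG₁, hG₂, mul_pow, mul_pow]
  ring

lemma coeff_eq_zero_of_auxFun_eq_zero
    (hind : ∀ u v : ℤ, Complex.exp (u * ℓ₁ + v * ℓ₂) = 1 → u = 0 ∧ v = 0)
    (hz : ∀ l < L₀ * (L * L), auxFun b₀ b₁ ℓ₁ ℓ₂ c 0 0 l = 0) : c = 0 := by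
  classical
  set W : Fin L × Fin L → ℂ := fun y => Complex.exp ((y.1 : ℕ) * ℓ₁ + (y.2 : ℕ) * ℓ₂) with hW
  have hWinj : Function.Injective W := by
    intro y y' h
    have h1 : Complex.exp ((((y.1 : ℕ) : ℤ) - ((y'.1 : ℕ) : ℤ) : ℤ) * ℓ₁ +
        (((y.2 : ℕ) : ℤ) - ((y'.2 : ℕ) : ℤ) : ℤ) * ℓ₂) = 1 := by
      have : (((((y.1 : ℕ) : ℤ) - ((y'.1 : ℕ) : ℤ) : ℤ) : ℂ) * ℓ₁ +
        ((((y.2 : ℕ) : ℤ) - ((y'.2 : ℕ) : ℤ) : ℤ) : ℂ) * ℓ₂) =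
        ((y.1 : ℕ) * ℓ₁ + (y.2 : ℕ) * ℓ₂) - ((y'.1 : ℕ) * ℓ₁ + (y'.2 : ℕ) * ℓ₂) := by
        push_cast; ring
      rw [this, Complex.exp_sub]
      exact (div_eq_one_iff_eq (Complex.exp_ne_zero _)).2 h
    obtain ⟨h2, h3⟩ := hind _ _ h1
    exact Prod.ext (Fin.ext (by omega)) (Fin.ext (by omega))
  set S : Finset ℂ := Finset.univ.image W with hS
  have hScard : S.card = L * L := by
    rw [hS, Finset.card_image_of_injective _ hWinj]; simp
  set q : ℂ → Polynomial ℂ := fun w => ∑ x : Fin L₀ × Fin L × Fin L with W x.2 = w,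
    Polynomial.monomial (x.1 : ℕ) (c x) with hq
  have hq0 : ∀ w ∈ S, q w = 0 := by
    refine exponentialPolynomial_eq_zero L₀ S q ?_ ?_ ?_
    · intro w hw
      obtain ⟨y, _, rfl⟩ := Finset.mem_image.1 hw
      exact Complex.exp_ne_zero _
    · intro w _
      refine Polynomial.mem_degreeLT.1 (Submodule.sum_mem _ fun x _ => ?_)
      exact Polynomial.mem_degreeLT.2
        ((Polynomial.degree_monomial_le _ _).trans_lt (by exact_mod_cast x.1.2))
    · intro l hl
      rw [hScard] at hl
      rw [← hz l hl, auxFun, ← Finset.sum_fiberwise_of_maps_to (s := Finset.univ) (t := S)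
        (g := fun x : Fin L₀ × Fin L × Fin L => W x.2)
        (fun x _ => Finset.mem_image_of_mem _ (Finset.mem_univ _))]
      refine Finset.sum_congr rfl fun w _ => ?_
      rw [hq, Polynomial.eval_finsetSum, Finset.sum_mul]
      refine Finset.sum_congr rfl fun x hx => ?_
      rw [← (Finset.mem_filter.1 hx).2, hW]
      simp only [Polynomial.eval_monomial, auxTerm, auxPoly, pow_zero, mul_one]
      rw [← Complex.exp_nat_mul, mul_comm (l : ℂ)]
  funext x
  have h1 := congrArg (fun p => p.coeff (x.1 : ℕ))
    (hq0 (W x.2) (Finset.mem_image_of_mem _ (Finset.mem_univ _)))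
  simp only [hq, Polynomial.finsetSum_coeff, Polynomial.coeff_zero] at h1
  rw [Finset.sum_eq_single x] at h1
  · simpa using h1
  · intro y hy hyx
    refine Polynomial.coeff_monomial_of_ne _ fun e => hyx ?_
    exact Prod.ext (Fin.ext e.symm) (hWinj (Finset.mem_filter.1 hy).2)
  · intro h
    exact absurd (by simp) h

end auxFun

section NumberField

open NumberField

lemma house_sum_le_card_mul {K ι : Type*} [Field K] [NumberField K] {s : Finset ι} {x : ι → K}
    {B : ℝ} (hx : ∀ i ∈ s, house (x i) ≤ B) : house (∑ i ∈ s, x i) ≤ s.card * B := by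
  refine (house_sum_le_sum_house s x).trans ?_
  rw [← nsmul_eq_mul]
  exact Finset.sum_le_card_nsmul _ _ _ hx

lemma house_le_of_forall_norm_le {K : Type*} [Field K] [NumberField K] {x : K} {B : ℝ}
    (hx : ∀ φ : K →+* ℂ, ‖φ x‖ ≤ B) : house x ≤ B := by
  obtain ⟨φ⟩ : Nonempty (K →+* ℂ) := inferInstance
  exact (pi_norm_le_iff_of_nonneg ((norm_nonneg _).trans (hx φ))).2 hx

/-- Siegel's lemma for twice as many unknowns as equations. -/
lemma exists_siegel_const (K : Type*) [Field K] [NumberField K] :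
    ∃ C₁ : ℝ, 1 ≤ C₁ ∧ ∀ (α β : Type) [Fintype α] [Fintype β] (a : Matrix α β (𝓞 K)) (A : ℝ),
      1 ≤ A → 0 < Fintype.card α → 2 * Fintype.card α ≤ Fintype.card β →
      (∀ k l, house (a k l : K) ≤ A) →
      ∃ ξ : β → 𝓞 K, ξ ≠ 0 ∧ a.mulVec ξ = 0 ∧
        ∀ l, house (ξ l : K) ≤ C₁ * (C₁ * Fintype.card β * A) := by
  classical
  obtain ⟨c, hc⟩ : ∃ c : ℝ, ∀ (α β : Type) [Fintype α] [Fintype β] (a : Matrix α β (𝓞 K)),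
      a ≠ 0 → ∀ (p q : ℕ), 0 < p → p < q → Fintype.card α = p → Fintype.card β = q → ∀ A : ℝ,
      (∀ k l, house (a k l : K) ≤ A) → ∃ ξ : β → 𝓞 K, ξ ≠ 0 ∧ a.mulVec ξ = 0 ∧
        ∀ l, house (ξ l : K) ≤ c * ((c * q * A) ^ ((p : ℝ) / (q - p))) :=
    ⟨_, fun α β _ _ a ha p q hp hpq hα hβ A hA =>
      house.exists_ne_zero_int_vec_house_le K a ha hp hpq hβ hA hα⟩
  refine ⟨max 1 |c|, le_max_left _ _, fun α β _ _ a A hA hα hαβ ha => ?_⟩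
  set C₁ := max 1 |c|
  have hC₁ : 1 ≤ C₁ := le_max_left _ _
  have hcC : |c| ≤ C₁ := le_max_right _ _
  have hq : (1 : ℝ) ≤ Fintype.card β := by exact_mod_cast (by omega : 1 ≤ Fintype.card β)
  have h1 : 1 ≤ C₁ * Fintype.card β * A := one_le_mul_of_one_le_of_one_le
    (one_le_mul_of_one_le_of_one_le hC₁ hq) hA
  by_cases ha0 : a = 0
  · refine ⟨fun _ => 1, ?_, by simp [ha0], fun l => ?_⟩
    · have : Nonempty β := Fintype.card_pos_iff.1 (by omega)
      intro h
      exact one_ne_zero (congrFun h (Classical.arbitrary β))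
    · have : house ((1 : 𝓞 K) : K) = 1 := by
        have := house_intCast (K := K) 1
        simpa using this
      rw [this]
      exact one_le_mul_of_one_le_of_one_le hC₁ h1
  · obtain ⟨ξ, h0, hm, hξ⟩ := hc α β a ha0 _ _ hα (by omega) rfl rfl A ha
    refine ⟨ξ, h0, hm, fun l => (hξ l).trans ?_⟩
    set p : ℝ := (Fintype.card α : ℝ)
    set q : ℝ := (Fintype.card β : ℝ)
    have hpq : 2 * p ≤ q := by simp only [p, q]; exact_mod_cast hαβ
    have hp : 0 < p := by simp only [p]; exact_mod_cast hα
    have hexp : p / (q - p) ≤ 1 := by rw [div_le_one (by linarith)]; linarith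
    have hexp0 : 0 ≤ p / (q - p) := div_nonneg hp.le (by linarith)
    have h2 : |(c * q * A) ^ (p / (q - p))| ≤ C₁ * q * A := by
      refine (Real.abs_rpow_le_abs_rpow _ _).trans ?_
      calc |c * q * A| ^ (p / (q - p)) ≤ (C₁ * q * A) ^ (p / (q - p)) := by
            refine Real.rpow_le_rpow (abs_nonneg _) ?_ hexp0
            rw [abs_mul, abs_mul, abs_of_nonneg (by linarith : (0 : ℝ) ≤ q),
              abs_of_nonneg (by linarith : (0 : ℝ) ≤ A)]
            gcongr
        _ ≤ (C₁ * q * A) ^ (1 : ℝ) := Real.rpow_le_rpow_of_exponent_le h1 hexp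
        _ = _ := Real.rpow_one _
    refine (le_abs_self _).trans ?_
    rw [abs_mul]
    gcongr

/-- Liouville's inequality. -/
lemma one_le_norm_mul_house_pow {K : Type*} [Field K] [NumberField K] (σ : K →+* ℂ) {x : 𝓞 K}
    (hx : x ≠ 0) {H : ℝ} (hH : house (x : K) ≤ H) :
    1 ≤ ‖σ x‖ * H ^ (Module.finrank ℚ K - 1) := by
  have hN : 1 ≤ ‖Algebra.norm ℚ (x : K)‖ := by
    obtain ⟨m, hm⟩ := IsIntegrallyClosed.isIntegral_iff.1
      (Algebra.isIntegral_norm ℚ (RingOfIntegers.isIntegral_coe x))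
    rw [← hm]
    have hm0 : m ≠ 0 := by
      rintro rfl
      rw [map_zero] at hm
      exact hx (RingOfIntegers.coe_eq_zero_iff.1 (Algebra.norm_eq_zero_iff.1 hm.symm))
    have : (1 : ℝ) ≤ |(m : ℝ)| := by exact_mod_cast Int.one_le_abs hm0
    simpa [← Rat.norm_cast_real] using this
  calc 1 ≤ ‖Algebra.norm ℚ (x : K)‖ := hN
    _ ≤ _ := norm_norm_le_norm_mul_house_pow _ σ
    _ ≤ _ := by gcongr; exact house_nonneg _

lemma house_auxVal_le {K : Type*} [Field K] [NumberField K] {b₀ b₁ G₁ G₂ : 𝓞 K} {d : ℕ}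
    {A ρ β : ℝ} {L l m₀ m₁ i j k : ℕ} (hρ : 1 ≤ ρ)
    (hl : l ≤ ρ) (h₀ : i + k * house (b₀ : K) ≤ A) (h₁ : j + k * house (b₁ : K) ≤ A)
    (hG₁ : house (G₁ : K) ≤ β)
    (hG₂ : house (G₂ : K) ≤ β) (hd : d ≤ β) (hj : j ≤ L) (hk : k ≤ L) :
    house ((auxVal b₀ b₁ G₁ G₂ d L l m₀ m₁ i j k : 𝓞 K) : K) ≤
      A ^ (m₀ + m₁) * ρ ^ i * β ^ (2 * L * l) := by
  refine house_le_of_forall_norm_le fun φ => ?_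
  have h := map_auxVal (φ.comp (algebraMap (𝓞 K) K)) b₀ b₁ G₁ G₂ d L l m₀ m₁ i j k
  refine (congrArg norm h).trans_le (norm_auxVal_le hρ hl ?_ ?_ ?_ ?_ ?_ hj hk)
  · refine le_trans ?_ h₀
    gcongr
    exact norm_embedding_le_house _ φ
  · refine le_trans ?_ h₁
    gcongr
    exact norm_embedding_le_house _ φ
  · exact (norm_embedding_le_house _ φ).trans hG₁
  · exact (norm_embedding_le_house _ φ).trans hG₂
  · simpa using hd

end NumberField

section Extrapolation

open NumberField

lemma pow_mul_pow_le_of_le_pow {n : ℕ} (hn : 15 ≤ n) {ρ : ℝ} (hρ : 1 ≤ ρ)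
    (hρn : ρ ≤ (n : ℝ) ^ 19) :
    (14 * (n : ℝ) ^ 7) ^ (2 * (9 * n ^ 7)) * ρ ^ (9 * n ^ 7) ≤ ((2 : ℝ) ^ 315) ^ n ^ 8 := by
  have hn' : (15 : ℝ) ≤ n := by exact_mod_cast hn
  have h1 : 14 * (n : ℝ) ^ 7 ≤ (n : ℝ) ^ 8 := by
    rw [pow_succ' (n : ℝ) 7]; gcongr; linarith
  have h2 : (n : ℝ) ≤ 2 ^ n := by exact_mod_cast Nat.lt_two_pow_self.le
  calc _ ≤ ((n : ℝ) ^ 8) ^ (2 * (9 * n ^ 7)) * ((n : ℝ) ^ 19) ^ (9 * n ^ 7) := by gcongr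
    _ = (n : ℝ) ^ (315 * n ^ 7) := by
      rw [← pow_mul, ← pow_mul, ← pow_add]; congr 1; ring
    _ ≤ ((2 : ℝ) ^ n) ^ (315 * n ^ 7) := by gcongr
    _ = _ := by rw [← pow_mul, ← pow_mul]; congr 1; ring

lemma card_le_pow {n : ℕ} (hn : 15 ≤ n) :
    ((9 * n ^ 7 * (5 * n ^ 4 * (5 * n ^ 4)) : ℕ) : ℝ) ≤ ((2 : ℝ) ^ 17) ^ n ^ 8 := by
  have h2 : n ≤ 2 ^ n := Nat.lt_two_pow_self.le
  have h3 : 9 * n ^ 7 * (5 * n ^ 4 * (5 * n ^ 4)) ≤ (2 ^ 17) ^ n ^ 8 := by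
    calc 9 * n ^ 7 * (5 * n ^ 4 * (5 * n ^ 4)) = (15 * 15) * n ^ 15 := by ring
      _ ≤ (n * n) * n ^ 15 := by gcongr
      _ = n ^ 17 := by ring
      _ ≤ (2 ^ n) ^ 17 := by gcongr
      _ = 2 ^ (17 * n) := by rw [← pow_mul, mul_comm]
      _ ≤ 2 ^ (17 * n ^ 8) := by
        gcongr
        · norm_num
        · exact Nat.le_self_pow (by norm_num) n
      _ = _ := by rw [pow_mul]
  exact_mod_cast h3

lemma pow_le_pow_mul_of_le {N F D a b c : ℝ} {E : ℕ} (hF : 0 ≤ F) (hN : 0 ≤ N) (ha : 0 ≤ a)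
    (hc : 0 ≤ c) (hD : D ≤ a ^ E) (hFb : F * N ^ E ≤ b ^ E) (h : 1 ≤ D * F * c ^ E) :
    N ^ E ≤ (a * b * c) ^ E := by
  calc N ^ E ≤ N ^ E * (D * F * c ^ E) := le_mul_of_one_le_right (by positivity) h
    _ = D * (F * N ^ E) * c ^ E := by ring
    _ ≤ a ^ E * b ^ E * c ^ E := by gcongr
    _ = _ := by rw [← mul_pow, ← mul_pow]

lemma map_sum_auxVal {K : Type*} [Field K] (σ : K →+* ℂ) {b₀ b₁ G₁ G₂ : 𝓞 K} {d : ℕ}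
    {ℓ₁ ℓ₂ : ℂ} (hσ₁ : σ G₁ = d * Complex.exp ℓ₁) (hσ₂ : σ G₂ = d * Complex.exp ℓ₂) {n : ℕ}
    (c : Fin (9 * n ^ 7) × Fin (5 * n ^ 4) × Fin (5 * n ^ 4) → 𝓞 K) (m₀ m₁ l : ℕ) :
    σ (∑ y : Fin (9 * n ^ 7) × Fin (5 * n ^ 4) × Fin (5 * n ^ 4),
        c y * auxVal b₀ b₁ G₁ G₂ d (5 * n ^ 4) l m₀ m₁ y.1 y.2.1 y.2.2 : 𝓞 K) =
      (d : ℂ) ^ (2 * (5 * n ^ 4) * l) *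
        auxFun (σ b₀) (σ b₁) ℓ₁ ℓ₂ (fun x => σ (c x)) m₀ m₁ l := by
  rw [← sum_auxVal_eq (fun x => σ (c x)) hσ₁ hσ₂]
  change (σ.comp (algebraMap (𝓞 K) K)) _ = _
  rw [map_sum]
  refine Finset.sum_congr rfl fun y _ => ?_
  rw [map_mul, map_auxVal, map_natCast]
  rfl

variable {K : Type*} [Field K] [NumberField K] (σ : K →+* ℂ) {b₀ b₁ G₁ G₂ : 𝓞 K} {d : ℕ}
  {ℓ₁ ℓ₂ : ℂ} {β : ℝ}

lemma le_mul_pow_seven {n a : ℕ} (hn : 15 ≤ n) (hβn : β ≤ n) (hβ : 0 ≤ β)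
    (ha : a ≤ 9 * n ^ 7) {x : ℝ} (hx : x ≤ β) {k : ℕ} (hk : k ≤ 5 * n ^ 4) :
    a + k * x ≤ 14 * (n : ℝ) ^ 7 := by
  have hn' : (15 : ℝ) ≤ n := by exact_mod_cast hn
  have ha' : (a : ℝ) ≤ 9 * (n : ℝ) ^ 7 := by exact_mod_cast ha
  have hk' : (k : ℝ) ≤ 5 * (n : ℝ) ^ 4 := by exact_mod_cast hk
  have hkx : k * x ≤ 5 * (n : ℝ) ^ 4 * n :=
    (mul_le_mul_of_nonneg_left hx k.cast_nonneg).trans (by gcongr)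
  calc a + k * x ≤ 9 * (n : ℝ) ^ 7 + 5 * (n : ℝ) ^ 4 * n := add_le_add ha' hkx
    _ = 9 * (n : ℝ) ^ 7 + 5 * (n : ℝ) ^ 5 := by ring
    _ ≤ 9 * (n : ℝ) ^ 7 + 5 * (n : ℝ) ^ 7 := by gcongr <;> linarith
    _ = _ := by ring

lemma house_auxVal_le_pow {n : ℕ} (hn : 15 ≤ n) (hβ : 1 ≤ β) (hβn : β ≤ n)
    (hb₀ : house (b₀ : K) ≤ β) (hb₁ : house (b₁ : K) ≤ β) (hG₁ : house (G₁ : K) ≤ β)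
    (hG₂ : house (G₂ : K) ≤ β) (hd : d ≤ β) {l h m₀ m₁ i j k : ℕ} (hl : l < h)
    (hh : h ≤ n ^ 17) (hm₀ : m₀ ≤ 9 * n ^ 7) (hm₁ : m₁ ≤ 9 * n ^ 7) (hi : i ≤ 9 * n ^ 7)
    (hj : j ≤ 5 * n ^ 4) (hk : k ≤ 5 * n ^ 4) :
    house ((auxVal b₀ b₁ G₁ G₂ d (5 * n ^ 4) l m₀ m₁ i j k : 𝓞 K) : K) ≤
      ((2 : ℝ) ^ 315) ^ n ^ 8 * β ^ (10 * n ^ 4 * h) := by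
  have hn' : (15 : ℝ) ≤ n := by exact_mod_cast hn
  have hβ0 : 0 ≤ β := by linarith
  have hh1 : (1 : ℝ) ≤ h := by exact_mod_cast (by omega : 1 ≤ h)
  have hj7 : j ≤ 9 * n ^ 7 := hj.trans (by
    have : n ^ 4 ≤ n ^ 7 := Nat.pow_le_pow_right (by omega) (by norm_num)
    omega)
  have hh2 : (h : ℝ) ≤ (n : ℝ) ^ 19 := by
    have : h ≤ n ^ 19 := hh.trans (Nat.pow_le_pow_right (by omega) (by norm_num))
    exact_mod_cast this
  refine (house_auxVal_le hh1 (by exact_mod_cast hl.le) (le_mul_pow_seven hn hβn hβ0 hi hb₀ hk)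
    (le_mul_pow_seven hn hβn hβ0 hj7 hb₁ hk) hG₁ hG₂ hd hj hk).trans ?_
  have h14 : 1 ≤ 14 * (n : ℝ) ^ 7 := by
    have : 1 ≤ (n : ℝ) ^ 7 := one_le_pow₀ (by linarith)
    linarith
  calc _ ≤ (14 * (n : ℝ) ^ 7) ^ (2 * (9 * n ^ 7)) * (h : ℝ) ^ (9 * n ^ 7) *
        β ^ (10 * n ^ 4 * h) := by
        gcongr ?_ ^ ?_ * ?_ ^ ?_ * ?_ ^ ?_
        · omega
        · calc 2 * (5 * n ^ 4) * l ≤ 2 * (5 * n ^ 4) * h := by gcongr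
            _ = _ := by ring
    _ ≤ _ := by
        gcongr
        exact pow_mul_pow_le_of_le_pow hn hh1 hh2

lemma auxFun_eq_zero_of_auxFun_eq_zero {n : ℕ} (hn : 15 ≤ n) (hβ : 1 ≤ β) (hβn : β ≤ n)
    (hb₀ : house (b₀ : K) ≤ β) (hb₁ : house (b₁ : K) ≤ β) (hG₁ : house (G₁ : K) ≤ β)
    (hG₂ : house (G₂ : K) ≤ β) (hd : d ≤ β) (hd0 : 0 < d) (hℓ₁ : ‖ℓ₁‖ ≤ β) (hℓ₂ : ‖ℓ₂‖ ≤ β)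
    (hℓ : ℓ₂ = σ b₀ + σ b₁ * ℓ₁) (hσ₁ : σ G₁ = d * Complex.exp ℓ₁)
    (hσ₂ : σ G₂ = d * Complex.exp ℓ₂) {Q : ℝ} (hQ : 1 ≤ Q)
    (hlarge : β ^ 10 * (2 ^ 17 * (Q * 2 ^ 315) * Real.exp (20 * β)) *
      (2 ^ 17 * (Q * (2 ^ 315 * β ^ 10))) ^ (Module.finrank ℚ K - 1) < n)
    {c : Fin (9 * n ^ 7) × Fin (5 * n ^ 4) × Fin (5 * n ^ 4) → 𝓞 K}
    (hc : ∀ x, house (c x : K) ≤ Q ^ n ^ 8) {M h : ℕ} (hnh : n ≤ h) (hhn : h ≤ n ^ 15)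
    (hM : M + n ^ 7 ≤ 9 * n ^ 7)
    (hz : ∀ m₀ < M + n ^ 7, ∀ m₁ < M + n ^ 7, ∀ l < h,
      auxFun (σ b₀) (σ b₁) ℓ₁ ℓ₂ (fun x => σ (c x)) m₀ m₁ l = 0) :
    ∀ m₀ < M, ∀ m₁ < M, ∀ l < h * n ^ 2,
      auxFun (σ b₀) (σ b₁) ℓ₁ ℓ₂ (fun x => σ (c x)) m₀ m₁ l = 0 := by
  intro m₀ hm₀ m₁ hm₁ l hl
  have hn' : (15 : ℝ) ≤ n := by exact_mod_cast hn
  have hβ0 : 0 ≤ β := by linarith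
  have hQ0 : 0 ≤ Q := by linarith
  set E := n ^ 7 * h with hE
  have h8E : n ^ 8 ≤ E := by rw [hE, pow_succ]; gcongr
  set x : 𝓞 K := ∑ y : Fin (9 * n ^ 7) × Fin (5 * n ^ 4) × Fin (5 * n ^ 4),
    c y * auxVal b₀ b₁ G₁ G₂ d (5 * n ^ 4) l m₀ m₁ y.1 y.2.1 y.2.2 with hx
  have hσx := map_sum_auxVal σ (b₀ := b₀) (b₁ := b₁) hσ₁ hσ₂ (n := n) c m₀ m₁ l
  rw [← hx] at hσx
  by_contra hne
  have hx0 : x ≠ 0 := by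
    intro h0
    rw [h0] at hσx
    simp only [map_zero] at hσx
    exact (mul_ne_zero (pow_ne_zero _ (Nat.cast_ne_zero.2 hd0.ne')) hne) hσx.symm
  have hcard : (Finset.univ : Finset (Fin (9 * n ^ 7) × Fin (5 * n ^ 4) × Fin (5 * n ^ 4))).card =
      9 * n ^ 7 * (5 * n ^ 4 * (5 * n ^ 4)) := by simp
  have hbig : β ^ (10 * n ^ 4 * (h * n ^ 2)) ≤ (β ^ 10) ^ E := by
    rw [← pow_mul]
    refine pow_le_pow_right₀ hβ ?_
    calc 10 * n ^ 4 * (h * n ^ 2) = 10 * (n ^ 6 * h) := by ring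
      _ ≤ 10 * (n ^ 7 * h) := by
        have : n ^ 6 ≤ n ^ 7 := Nat.pow_le_pow_right (by omega) (by norm_num)
        gcongr
  have hlift {y : ℝ} (hy : 1 ≤ y) : y ^ n ^ 8 ≤ y ^ E := pow_le_pow_right₀ hy h8E
  have h315 : (1 : ℝ) ≤ 2 ^ 315 := one_le_pow₀ (by norm_num)
  have h17 : (1 : ℝ) ≤ 2 ^ 17 := one_le_pow₀ (by norm_num)
  have hhn2 : h * n ^ 2 ≤ n ^ 17 := by
    calc h * n ^ 2 ≤ n ^ 15 * n ^ 2 := by gcongr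
      _ = n ^ 17 := by ring
  have hhn1 : (1 : ℝ) ≤ h := by exact_mod_cast (by omega : 1 ≤ h)
  have hcard' := card_le_pow hn
  have hhouse : house (x : K) ≤ (2 ^ 17 * (Q * (2 ^ 315 * β ^ 10))) ^ E := by
    have hxK : (x : K) = ∑ y : Fin (9 * n ^ 7) × Fin (5 * n ^ 4) × Fin (5 * n ^ 4),
        (c y : K) * ((auxVal b₀ b₁ G₁ G₂ d (5 * n ^ 4) l m₀ m₁ y.1 y.2.1 y.2.2 : 𝓞 K) : K) := by
      rw [hx]
      simp
    have hterm : ∀ y ∈ (Finset.univ :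
        Finset (Fin (9 * n ^ 7) × Fin (5 * n ^ 4) × Fin (5 * n ^ 4))),
        house ((c y : K) * ((auxVal b₀ b₁ G₁ G₂ d (5 * n ^ 4) l m₀ m₁ y.1 y.2.1 y.2.2 :
          𝓞 K) : K)) ≤ Q ^ n ^ 8 * ((2 ^ 315) ^ n ^ 8 * β ^ (10 * n ^ 4 * (h * n ^ 2))) := by
      intro y _
      refine (house_mul_le _ _).trans (mul_le_mul (hc y) ?_ (house_nonneg _) (by positivity))
      exact house_auxVal_le_pow hn hβ hβn hb₀ hb₁ hG₁ hG₂ hd hl hhn2 (by omega) (by omega)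
        y.1.2.le y.2.1.2.le y.2.2.2.le
    rw [hxK]
    refine (house_sum_le_card_mul hterm).trans ?_
    rw [hcard, mul_pow _ _ E, mul_pow _ _ E, mul_pow _ _ E]
    gcongr
    exact hcard'.trans (hlift h17)
  have hρ1 : 1 ≤ 2 * (n : ℝ) * (h * n ^ 2) := by
    have : 1 ≤ (n : ℝ) ^ 2 := one_le_pow₀ (by linarith)
    exact one_le_mul_of_one_le_of_one_le (by linarith) (one_le_mul_of_one_le_of_one_le hhn1 this)
  have hρn : 2 * (n : ℝ) * (h * n ^ 2) ≤ (n : ℝ) ^ 19 := by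
    have h' : (h : ℝ) ≤ (n : ℝ) ^ 15 := by exact_mod_cast hhn
    calc 2 * (n : ℝ) * (h * n ^ 2) ≤ n * n * (n ^ 15 * n ^ 2) := by gcongr; linarith
      _ = _ := by ring
  have hsmall : ‖auxFun (σ b₀) (σ b₁) ℓ₁ ℓ₂ (fun x => σ (c x)) m₀ m₁ l‖ * (n : ℝ) ^ E ≤
      (2 ^ 17 * (Q * 2 ^ 315) * Real.exp (20 * β)) ^ E := by
    refine norm_mul_pow_le_of_le_analyticOrderAt (r := h * n ^ 2)
      (differentiable_auxFun _ hℓ _ _) (fun l' hl' => ?_) ?_ (by positivity) (by linarith)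
      (fun z hz' => ?_) (by exact_mod_cast hl.le)
    · exact le_analyticOrderAt_auxFun _ hℓ (fun m hm m' hm' => hz m hm m' hm' l' hl') _ _ _
        (by omega) (by omega)
    · exact le_mul_of_one_le_right (by positivity) (one_le_pow₀ (by linarith))
    · have h7 : n ^ 4 ≤ n ^ 7 := Nat.pow_le_pow_right (by omega) (by norm_num)
      have h14 : 1 ≤ 14 * (n : ℝ) ^ 7 := by
        have : 1 ≤ (n : ℝ) ^ 7 := one_le_pow₀ (by linarith)
        linarith
      refine (norm_auxFun_le (A := 14 * (n : ℝ) ^ 7) (M := 9 * n ^ 7) (P := Q ^ n ^ 8) _ hρ1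
        (le_mul_pow_seven hn hβn hβ0 le_rfl ((norm_embedding_le_house _ σ).trans hb₀) le_rfl)
        (le_mul_pow_seven hn hβn hβ0 (by omega) ((norm_embedding_le_house _ σ).trans hb₁) le_rfl)
        h14 hℓ₁ hℓ₂ (fun y => (norm_embedding_le_house _ σ).trans (hc y)) (by omega) (by omega)
        hz'.le).trans ?_
      have hexp : Real.exp (2 * (5 * n ^ 4 : ℕ) * β * (2 * (n : ℝ) * (h * n ^ 2))) =
          Real.exp (20 * β) ^ E := by
        rw [← Real.exp_nat_mul, hE]
        congr 1
        push_cast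
        ring
      rw [hexp, mul_pow _ _ E, mul_pow _ _ E, mul_pow _ _ E]
      refine (mul_assoc _ _ _).ge.trans ?_
      gcongr
      · exact hcard'.trans (hlift h17)
      · exact (pow_mul_pow_le_of_le_pow hn hρ1 hρn).trans (hlift h315)
  have hdle : ‖(d : ℂ) ^ (2 * (5 * n ^ 4) * l)‖ ≤ (β ^ 10) ^ E := by
    rw [norm_pow, Complex.norm_natCast]
    calc (d : ℝ) ^ (2 * (5 * n ^ 4) * l) ≤ β ^ (2 * (5 * n ^ 4) * l) := by gcongr
      _ ≤ β ^ (10 * n ^ 4 * (h * n ^ 2)) := by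
        refine pow_le_pow_right₀ hβ ?_
        calc 2 * (5 * n ^ 4) * l = 10 * n ^ 4 * l := by ring
          _ ≤ _ := by gcongr
      _ ≤ _ := hbig
  have hliou := one_le_norm_mul_house_pow σ hx0 hhouse
  rw [hσx, norm_mul, pow_right_comm _ E] at hliou
  have hF := norm_nonneg (auxFun (σ b₀) (σ b₁) ℓ₁ ℓ₂ (fun x => σ (c x)) m₀ m₁ l)
  exact absurd (pow_le_pow_mul_of_le hF (by positivity) (by positivity) (by positivity)
    hdle hsmall hliou) (not_le.2 (pow_lt_pow_left₀ hlarge (by positivity)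
    (Nat.mul_pos (by positivity) (by omega)).ne'))

end Extrapolation

section Independence

open NumberField

/-- There is no linear relation `ℓ₂ = b₀ + b₁ ℓ₁` with algebraic integers `b₀`, `b₁` of a number
field between two logarithms of elements of this field that are multiplicatively independent. -/
theorem false_of_eq_add_mul {K : Type*} [Field K] [NumberField K] (σ : K →+* ℂ)
    {b₀ b₁ G₁ G₂ : 𝓞 K} {d : ℕ} (hd0 : 0 < d) {ℓ₁ ℓ₂ : ℂ} (hℓ : ℓ₂ = σ b₀ + σ b₁ * ℓ₁)
    (hσ₁ : σ G₁ = d * Complex.exp ℓ₁) (hσ₂ : σ G₂ = d * Complex.exp ℓ₂)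
    (hind : ∀ u v : ℤ, Complex.exp (u * ℓ₁ + v * ℓ₂) = 1 → u = 0 ∧ v = 0) : False := by
  obtain ⟨C₁, hC₁, hS⟩ := exists_siegel_const K
  obtain ⟨β, hβ, hb₀, hb₁, hG₁, hG₂, hd, hℓ₁, hℓ₂⟩ : ∃ β : ℝ, 1 ≤ β ∧ house (b₀ : K) ≤ β ∧
      house (b₁ : K) ≤ β ∧ house (G₁ : K) ≤ β ∧ house (G₂ : K) ≤ β ∧ d ≤ β ∧ ‖ℓ₁‖ ≤ β ∧
      ‖ℓ₂‖ ≤ β := by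
    have h₁ := house_nonneg (b₀ : K)
    have h₂ := house_nonneg (b₁ : K)
    have h₃ := house_nonneg (G₁ : K)
    have h₄ := house_nonneg (G₂ : K)
    have h₅ : (0 : ℝ) ≤ d := d.cast_nonneg
    have h₆ := norm_nonneg ℓ₁
    have h₇ := norm_nonneg ℓ₂
    refine ⟨1 + house (b₀ : K) + house (b₁ : K) + house (G₁ : K) + house (G₂ : K) + d + ‖ℓ₁‖ +
      ‖ℓ₂‖, ?_, ?_, ?_, ?_, ?_, ?_, ?_, ?_⟩ <;> linarith
  have h315 : (1 : ℝ) ≤ 2 ^ 315 := one_le_pow₀ (by norm_num)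
  have h17 : (1 : ℝ) ≤ 2 ^ 17 := one_le_pow₀ (by norm_num)
  have hβ10 : 1 ≤ β ^ 10 := one_le_pow₀ hβ
  set Q : ℝ := C₁ ^ 2 * (2 ^ 17 * (2 ^ 315 * β ^ 10)) with hQdef
  have hQ : 1 ≤ Q := one_le_mul_of_one_le_of_one_le (one_le_pow₀ hC₁)
    (one_le_mul_of_one_le_of_one_le h17 (one_le_mul_of_one_le_of_one_le h315 hβ10))
  obtain ⟨n, hn'⟩ := exists_nat_gt (max (max 15 β)
    (β ^ 10 * (2 ^ 17 * (Q * 2 ^ 315) * Real.exp (20 * β)) *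
      (2 ^ 17 * (Q * (2 ^ 315 * β ^ 10))) ^ (Module.finrank ℚ K - 1)))
  have hlarge := (le_max_right _ _).trans_lt hn'
  have hβn : β ≤ n := ((le_max_right _ _).trans (le_max_left _ _)).trans hn'.le
  have hn : 15 ≤ n := by
    exact_mod_cast (((le_max_left _ _).trans (le_max_left _ _)).trans hn'.le : (15 : ℝ) ≤ n)
  obtain ⟨c, hc0, hcz, hc⟩ := hS (Fin (9 * n ^ 7) × Fin (9 * n ^ 7) × Fin n)
    (Fin (9 * n ^ 7) × Fin (5 * n ^ 4) × Fin (5 * n ^ 4))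
    (fun x y => auxVal b₀ b₁ G₁ G₂ d (5 * n ^ 4) x.2.2 x.1 x.2.1 y.1 y.2.1 y.2.2)
    ((2 ^ 315 * β ^ 10) ^ n ^ 8) (one_le_pow₀ (one_le_mul_of_one_le_of_one_le h315 hβ10))
    (by
      simp only [Fintype.card_prod, Fintype.card_fin]
      positivity)
    (by
      simp only [Fintype.card_prod, Fintype.card_fin]
      calc 2 * (9 * n ^ 7 * (9 * n ^ 7 * n)) = 162 * n ^ 15 := by ring
        _ ≤ 225 * n ^ 15 := by gcongr; norm_num
        _ = _ := by ring)
    (fun x y => by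
      refine (house_auxVal_le_pow hn hβ hβn hb₀ hb₁ hG₁ hG₂ hd x.2.2.2
        (Nat.le_self_pow (by norm_num) n) x.1.2.le x.2.1.2.le y.1.2.le y.2.1.2.le
        y.2.2.2.le).trans ?_
      rw [mul_pow, ← pow_mul β]
      refine mul_le_mul_of_nonneg_left (pow_le_pow_right₀ hβ ?_) (by positivity)
      calc 10 * n ^ 4 * n = 10 * n ^ 5 := by ring
        _ ≤ 10 * n ^ 8 := by gcongr <;> omega)
  have hcQ : ∀ y, house (c y : K) ≤ Q ^ n ^ 8 := fun y => by
    refine (hc y).trans ?_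
    have hcard : (Fintype.card (Fin (9 * n ^ 7) × Fin (5 * n ^ 4) × Fin (5 * n ^ 4)) : ℝ) ≤
        (2 ^ 17) ^ n ^ 8 := by
      simpa using card_le_pow hn
    have hC₁' : C₁ ^ 2 ≤ (C₁ ^ 2) ^ n ^ 8 :=
      le_self_pow₀ (one_le_pow₀ hC₁) (by positivity)
    rw [hQdef, mul_pow (C₁ ^ 2), mul_pow (2 ^ 17)]
    calc _ = C₁ ^ 2 * (Fintype.card (Fin (9 * n ^ 7) × Fin (5 * n ^ 4) × Fin (5 * n ^ 4)) *
          (2 ^ 315 * β ^ 10) ^ n ^ 8) := by rw [mul_assoc C₁, ← mul_assoc C₁ C₁, sq]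
      _ ≤ _ := by gcongr
  have hvan : ∀ i ≤ 8, ∀ m₀ < (9 - i) * n ^ 7, ∀ m₁ < (9 - i) * n ^ 7,
      ∀ l < n ^ (1 + 2 * i),
        auxFun (σ b₀) (σ b₁) ℓ₁ ℓ₂ (fun x => σ (c x)) m₀ m₁ l = 0 := by
    intro i
    induction i with
    | zero =>
      intro _ m₀ hm₀ m₁ hm₁ l hl
      have h := congrFun hcz (⟨m₀, hm₀⟩, ⟨m₁, hm₁⟩, ⟨l, by simpa using hl⟩)
      have h2 := map_sum_auxVal σ (b₀ := b₀) (b₁ := b₁) hσ₁ hσ₂ c m₀ m₁ l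
      simp only [Matrix.mulVec, dotProduct, Pi.zero_apply] at h
      simp only [mul_comm (c _), h, map_zero] at h2
      exact (mul_eq_zero.1 h2.symm).resolve_left
        (pow_ne_zero _ (Nat.cast_ne_zero.2 hd0.ne'))
    | succ i ih =>
      intro hi
      have hpow : n ^ (1 + 2 * (i + 1)) = n ^ (1 + 2 * i) * n ^ 2 := by ring
      have hM : (9 - (i + 1)) * n ^ 7 + n ^ 7 = (9 - i) * n ^ 7 := by
        rw [← Nat.succ_mul]
        congr 1
        omega
      rw [hpow]
      refine auxFun_eq_zero_of_auxFun_eq_zero σ hn hβ hβn hb₀ hb₁ hG₁ hG₂ hd hd0 hℓ₁ hℓ₂ hℓ hσ₁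
        hσ₂ hQ hlarge hcQ (Nat.le_self_pow (by omega) n)
        (Nat.pow_le_pow_right (by omega) (by omega)) ?_ ?_
      · rw [hM]
        gcongr
        omega
      · rw [hM]
        exact ih (by omega)
  have hzero := coeff_eq_zero_of_auxFun_eq_zero (fun x => σ (c x)) hind fun l hl =>
    hvan 8 le_rfl 0 (by positivity) 0 (by positivity) l (hl.trans_le ?_)
  · refine hc0 (funext fun y => ?_)
    have := congrFun hzero y
    simpa using this
  · calc 9 * n ^ 7 * (5 * n ^ 4 * (5 * n ^ 4)) = (15 * 15) * n ^ 15 := by ring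
      _ ≤ (n * n) * n ^ 15 := by gcongr
      _ = n ^ (1 + 2 * 8) := by ring

end Independence

section Real

open NumberField

lemma exists_nat_mul_isIntegral {K : Type*} [Field K] [NumberField K] (x y : K) :
    ∃ d : ℕ, 0 < d ∧ IsIntegral ℤ (d * x) ∧ IsIntegral ℤ (d * y) := by
  classical
  obtain ⟨a, ha, h⟩ := exists_integral_multiples ℤ ℚ ({x, y} : Finset K)
  have key : ∀ z ∈ ({x, y} : Finset K), IsIntegral ℤ (((a.natAbs ^ 2 : ℕ) : K) * z) := by
    intro z hz
    have h2 : ((a.natAbs ^ 2 : ℕ) : K) = (a : K) ^ 2 := by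
      rw [← Int.cast_natCast, Int.natCast_pow, Int.natCast_natAbs, sq_abs, Int.cast_pow]
    have h3 := (isIntegral_algebraMap (R := ℤ) (A := K) (x := a)).mul (h z hz)
    rw [h2, sq, mul_assoc]
    simpa [zsmul_eq_mul] using h3
  exact ⟨a.natAbs ^ 2, by positivity, key x (by simp), key y (by simp)⟩

/-- Baker's theorem for two linearly independent real logarithms, in inhomogeneous form. -/
theorem false_of_isAlgebraic_of_eq_add_mul {b₀ b₁ ℓ₁ ℓ₂ : ℝ} (hb₀ : IsAlgebraic ℚ b₀)
    (hb₁ : IsAlgebraic ℚ b₁) (hℓ₁ : IsAlgebraic ℚ (Real.exp ℓ₁))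
    (hℓ₂ : IsAlgebraic ℚ (Real.exp ℓ₂)) (hℓ : ℓ₂ = b₀ + b₁ * ℓ₁)
    (hind : ∀ u v : ℤ, u * ℓ₁ + v * ℓ₂ = 0 → u = 0 ∧ v = 0) : False := by
  let S : Set ℝ := {b₀, b₁, Real.exp ℓ₁, Real.exp ℓ₂}
  let K := IntermediateField.adjoin ℚ S
  have hfin : FiniteDimensional ℚ K := by
    have : Finite S := Set.toFinite S
    refine IntermediateField.finiteDimensional_adjoin fun x hx => ?_
    rcases hx with rfl | rfl | rfl | rfl
    exacts [hb₀.isIntegral, hb₁.isIntegral, hℓ₁.isIntegral, hℓ₂.isIntegral]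
  have : NumberField K := { to_charZero := inferInstance, to_finiteDimensional := hfin }
  have hmem : ∀ x ∈ S, x ∈ K := fun x hx => IntermediateField.subset_adjoin ℚ S hx
  obtain ⟨x₀, hx₀⟩ : ∃ x : K, (x : ℝ) = b₀ := ⟨⟨b₀, hmem _ (by simp [S])⟩, rfl⟩
  obtain ⟨x₁, hx₁⟩ : ∃ x : K, (x : ℝ) = b₁ := ⟨⟨b₁, hmem _ (by simp [S])⟩, rfl⟩
  obtain ⟨y₁, hy₁⟩ : ∃ x : K, (x : ℝ) = Real.exp ℓ₁ := ⟨⟨Real.exp ℓ₁, hmem _ (by simp [S])⟩, rfl⟩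
  obtain ⟨y₂, hy₂⟩ : ∃ x : K, (x : ℝ) = Real.exp ℓ₂ := ⟨⟨Real.exp ℓ₂, hmem _ (by simp [S])⟩, rfl⟩
  obtain ⟨a, ha, ha₀, ha₁⟩ := exists_nat_mul_isIntegral x₀ x₁
  obtain ⟨d, hd, hd₁, hd₂⟩ := exists_nat_mul_isIntegral y₁ (y₂ ^ a)
  let σ : K →+* ℂ := Complex.ofRealHom.comp (algebraMap K ℝ)
  have hσ : ∀ x : K, σ x = ((x : ℝ) : ℂ) := fun x => rfl
  refine false_of_eq_add_mul σ (b₀ := ⟨_, ha₀⟩) (b₁ := ⟨_, ha₁⟩) (G₁ := ⟨_, hd₁⟩)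
    (G₂ := ⟨_, hd₂⟩) hd (ℓ₁ := ℓ₁) (ℓ₂ := a * ℓ₂) ?_ ?_ ?_ fun u v huv => ?_
  · change _ = σ (a * x₀) + σ (a * x₁) * _
    rw [map_mul, map_mul, hσ x₀, hσ x₁, hx₀, hx₁, hℓ, map_natCast]
    push_cast
    ring
  · change σ (d * y₁) = _
    rw [map_mul, hσ y₁, hy₁, map_natCast, Complex.ofReal_exp]
  · change σ (d * y₂ ^ a) = _
    rw [map_mul, map_pow, hσ y₂, hy₂, map_natCast, Complex.ofReal_exp, Complex.exp_nat_mul]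
  · have h1 : Real.exp (u * ℓ₁ + v * (a * ℓ₂)) = 1 := by
      exact_mod_cast huv
    obtain ⟨hu, hv⟩ := hind u (v * a) (by
      push_cast
      rw [mul_assoc]
      exact Real.exp_eq_one_iff _ |>.1 h1)
    exact ⟨hu, (mul_eq_zero.1 hv).resolve_right (by exact_mod_cast ha.ne')⟩

/-- Hermite–Lindemann for real numbers. -/
theorem eq_zero_of_isAlgebraic_exp {ℓ : ℝ} (h : IsAlgebraic ℚ ℓ)
    (h' : IsAlgebraic ℚ (Real.exp ℓ)) : ℓ = 0 := by
  by_contra hne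
  have hlog {p : ℕ} (hp : 2 ≤ p) : ∃ u v : ℤ, u * Real.log p + v * ℓ = 0 ∧ u ≠ 0 ∧ v ≠ 0 := by
    have hlp : Real.log p ≠ 0 := (Real.log_pos (by exact_mod_cast hp)).ne'
    by_contra hcon
    push Not at hcon
    refine false_of_isAlgebraic_of_eq_add_mul (b₀ := ℓ) (b₁ := 0) (ℓ₁ := Real.log p) (ℓ₂ := ℓ)
      h isAlgebraic_zero ?_ h' (by ring) fun u v huv => ?_
    · rw [Real.exp_log (by exact_mod_cast (by omega : 0 < p))]
      exact isAlgebraic_natCast p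
    · by_cases hu : u = 0
      · subst hu
        simpa [hne] using huv
      · have hv := hcon u v huv hu
        subst hv
        simp [hu, hlp] at huv
  obtain ⟨u, v, h2, hu, hv⟩ := hlog (p := 2) le_rfl
  obtain ⟨u', v', h3, hu', hv'⟩ := hlog (p := 3) (by norm_num)
  have hlogs : (u * v' : ℤ) * Real.log 2 = (u' * v : ℤ) * Real.log 3 := by
    push_cast at h2 h3 ⊢
    linear_combination (v' : ℝ) * h2 - v * h3
  have huv : u * v' ≠ 0 := mul_ne_zero hu hv'
  generalize u * v' = p, u' * v = q at hlogs huv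
  have habs := congrArg (|·|) hlogs
  simp only [abs_mul, ← Int.cast_abs, Int.abs_eq_natAbs, abs_of_pos (Real.log_pos one_lt_two),
    abs_of_pos (Real.log_pos (by norm_num : (1 : ℝ) < 3)), Int.cast_natCast] at habs
  rw [← Real.log_pow, ← Real.log_pow] at habs
  have hpow := Real.log_injOn_pos (by simp) (by simp) habs
  norm_cast at hpow
  have hdvd : 2 ∣ 3 ^ q.natAbs := hpow ▸ dvd_pow_self 2 (by simpa using huv)
  exact absurd (Nat.Prime.dvd_of_dvd_pow Nat.prime_two hdvd) (by norm_num)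

/-- Baker's theorem for an inhomogeneous linear form in two real logarithms. -/
theorem add_mul_add_mul_ne_zero {b₀ b₁ b₂ ℓ₁ ℓ₂ : ℝ} (hb₀ : IsAlgebraic ℚ b₀)
    (hb₁ : IsAlgebraic ℚ b₁) (hb₂ : IsAlgebraic ℚ b₂) (hℓ₁ : IsAlgebraic ℚ (Real.exp ℓ₁))
    (hℓ₂ : IsAlgebraic ℚ (Real.exp ℓ₂)) (h0 : b₀ ≠ 0) : b₀ + b₁ * ℓ₁ + b₂ * ℓ₂ ≠ 0 := by
  intro h
  have hdep {b ℓ : ℝ} (hb : IsAlgebraic ℚ b) (hℓ : IsAlgebraic ℚ (Real.exp ℓ)) :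
      b₀ + b * ℓ ≠ 0 := by
    intro h
    have hb0 : b ≠ 0 := by
      rintro rfl
      exact h0 (by simpa using h)
    have hℓ' : ℓ = -b₀ / b := by
      field_simp
      linarith
    have := eq_zero_of_isAlgebraic_exp (ℓ := ℓ) (hℓ' ▸ (hb₀.neg.mul hb.inv)) hℓ
    simp [this, h0] at h
  by_cases h2 : b₂ = 0
  · exact hdep hb₁ hℓ₁ (by simpa [h2] using h)
  have hrel : ℓ₂ = -b₀ / b₂ + -b₁ / b₂ * ℓ₁ := by
    field_simp
    linarith
  refine false_of_isAlgebraic_of_eq_add_mul (hb₀.neg.mul hb₂.inv) (hb₁.neg.mul hb₂.inv) hℓ₁ hℓ₂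
    hrel fun u v huv => ?_
  by_contra hne
  have huA : IsAlgebraic ℚ (u : ℝ) := isAlgebraic_intCast u
  have hvA : IsAlgebraic ℚ (v : ℝ) := isAlgebraic_intCast v
  by_cases hu : u = 0
  · have hv : (v : ℝ) ≠ 0 := by
      intro hv
      exact hne ⟨hu, by exact_mod_cast hv⟩
    have : ℓ₂ = 0 := by simpa [hu, hv] using huv
    exact hdep hb₁ hℓ₁ (by simpa [this] using h)
  · have hu' : (u : ℝ) ≠ 0 := by exact_mod_cast hu
    have h1 : ℓ₁ = -v / u * ℓ₂ := by
      field_simp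
      linarith
    refine hdep (b := b₁ * (-v / u) + b₂) ((hb₁.mul (hvA.neg.mul huA.inv)).add hb₂) hℓ₂ ?_
    rw [h1] at h
    linarith

end Real

section Calculus

lemma hasDerivAt_mul_abs (x : ℝ) : HasDerivAt (fun x : ℝ => x * |x|) (2 * |x|) x := by
  rcases lt_trichotomy x 0 with hx | rfl | hx
  · refine ((hasDerivAt_id x).mul (hasDerivAt_abs_neg hx)).congr_deriv ?_
    simp [abs_of_neg hx]
    ring
  · rw [hasDerivAt_iff_tendsto_slope_zero]
    have h : Filter.Tendsto (fun t : ℝ => |t|) (nhdsWithin 0 {0}ᶜ) (nhds 0) := by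
      simpa using (continuous_abs.tendsto (0 : ℝ)).mono_left nhdsWithin_le_nhds
    simp only [abs_zero, mul_zero]
    refine h.congr' ?_
    filter_upwards [self_mem_nhdsWithin] with t ht
    simp [inv_mul_cancel_left₀ (show t ≠ 0 from ht)]
  · refine ((hasDerivAt_id x).mul (hasDerivAt_abs_pos hx)).congr_deriv ?_
    simp [abs_of_pos hx]
    ring

lemma hasDerivAt_sq_mul_log (x : ℝ) :
    HasDerivAt (fun x : ℝ => x ^ 2 * Real.log x) (2 * (x * Real.log x) + x) x := by
  rcases eq_or_ne x 0 with rfl | hx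
  · rw [hasDerivAt_iff_tendsto_slope_zero]
    have h : Filter.Tendsto (fun t : ℝ => t * Real.log t) (nhdsWithin 0 {0}ᶜ) (nhds 0) := by
      simpa using (Real.continuous_mul_log.tendsto (0 : ℝ)).mono_left nhdsWithin_le_nhds
    simp only [zero_mul, mul_zero, add_zero]
    refine h.congr' ?_
    filter_upwards [self_mem_nhdsWithin] with t ht
    have ht : t ≠ 0 := ht
    simp only [zero_add, smul_eq_mul]
    field_simp
    simp
  · refine ((hasDerivAt_pow 2 x).mul (Real.hasDerivAt_log hx)).congr_deriv ?_
    field_simp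
    push_cast
    ring

/-- The primitive in `u` of `√(u² + c²)` that vanishes at `u = 0`. -/
noncomputable def sqrtPrim (c u : ℝ) : ℝ :=
  (u * √(u ^ 2 + c ^ 2) + c ^ 2 * Real.log (u + √(u ^ 2 + c ^ 2)) - c ^ 2 * Real.log c) / 2

lemma add_sqrt_sq_add_sq_pos {c u : ℝ} (h : 0 < u ∨ c ≠ 0) : 0 < u + √(u ^ 2 + c ^ 2) := by
  rcases h with h | h
  · positivity
  · have h1 : |u| < √(u ^ 2 + c ^ 2) := by
      rw [← Real.sqrt_sq_eq_abs]
      exact Real.sqrt_lt_sqrt (sq_nonneg u) (by have : 0 < c ^ 2 := by positivity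
                                                linarith)
    linarith [neg_abs_le u]

lemma hasDerivAt_sqrtPrim_comp {f g : ℝ → ℝ} {f' g' x : ℝ} (hf : HasDerivAt f f' x)
    (hg : HasDerivAt g g' x) (h : 0 < f x ∨ g x ≠ 0) :
    HasDerivAt (fun x => sqrtPrim (g x) (f x))
      (f' * √(f x ^ 2 + g x ^ 2) +
        g' * (g x * (Real.log (f x + √(f x ^ 2 + g x ^ 2)) - Real.log (g x)))) x := by
  have hpos := add_sqrt_sq_add_sq_pos h
  have hsum : 0 < f x ^ 2 + g x ^ 2 := by
    rcases h with h | h <;> positivity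
  have hR := ((hf.pow 2).add (hg.pow 2)).sqrt hsum.ne'
  have hlog := (hf.add hR).log hpos.ne'
  have hsq := (hasDerivAt_sq_mul_log (g x)).comp x hg
  refine ((((hf.mul hR).add ((hg.pow 2).mul hlog)).sub hsq).div_const 2).congr_deriv ?_
  have hRsq := Real.sq_sqrt hsum.le
  simp only [Pi.add_apply, Pi.pow_apply]
  have hR0 : √(f x ^ 2 + g x ^ 2) ≠ 0 := (Real.sqrt_pos.2 hsum).ne'
  set R := √(f x ^ 2 + g x ^ 2)
  have hpos' := hpos.ne'
  field_simp
  norm_num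
  linear_combination (-(2 * f' * R + 2 * f' * f x + 2 * g x * g')) * hRsq

lemma hasDerivAt_sqrtPrim (c u : ℝ) : HasDerivAt (sqrtPrim c) (√(u ^ 2 + c ^ 2)) u := by
  rcases eq_or_ne c 0 with rfl | hc
  · refine (((hasDerivAt_mul_abs u).div_const 2).congr_deriv ?_).congr_of_eventuallyEq
      (Filter.Eventually.of_forall fun v => ?_)
    · simp [Real.sqrt_sq_eq_abs]
    · simp [sqrtPrim, Real.sqrt_sq_eq_abs]
  · simpa using hasDerivAt_sqrtPrim_comp (hasDerivAt_id u) (hasDerivAt_const u c) (Or.inr hc)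

lemma integral_sqrt_sub_sq_add_sq (m c p q : ℝ) :
    ∫ t in p..q, √((t - m) ^ 2 + c ^ 2) = sqrtPrim c (q - m) - sqrtPrim c (p - m) := by
  rw [intervalIntegral.integral_comp_sub_right (fun u => √(u ^ 2 + c ^ 2)) m]
  exact intervalIntegral.integral_eq_sub_of_hasDerivAt (fun u _ => hasDerivAt_sqrtPrim c u)
    (Continuous.intervalIntegrable (by fun_prop) _ _)

lemma integral_abs_sub (m p q : ℝ) :
    ∫ t in p..q, |t - m| = ((q - m) * |q - m| - (p - m) * |p - m|) / 2 := by
  rw [intervalIntegral.integral_comp_sub_right (fun u => |u|) m, sub_div]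
  exact intervalIntegral.integral_eq_sub_of_hasDerivAt (f := fun u => u * |u| / 2)
    (fun u _ => ((hasDerivAt_mul_abs u).div_const 2).congr_deriv (by ring))
    (Continuous.intervalIntegrable (by fun_prop) _ _)

lemma sqrtPrim_neg (c u : ℝ) : sqrtPrim c (-u) = -sqrtPrim c u := by
  rcases eq_or_ne c 0 with rfl | hc
  · simp only [sqrtPrim]
    simp
    ring
  · have h1 := add_sqrt_sq_add_sq_pos (u := u) (Or.inr hc)
    have h2 := add_sqrt_sq_add_sq_pos (u := -u) (Or.inr hc)
    rw [neg_sq] at h2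
    have h3 : Real.log (-u + √(u ^ 2 + c ^ 2)) + Real.log (u + √(u ^ 2 + c ^ 2)) =
        2 * Real.log c := by
      rw [← Real.log_mul h2.ne' h1.ne', two_mul, ← Real.log_mul hc hc]
      congr 1
      have := Real.sq_sqrt (by positivity : 0 ≤ u ^ 2 + c ^ 2)
      linear_combination this
    simp only [sqrtPrim, neg_sq]
    linear_combination c ^ 2 / 2 * h3

lemma sqrtPrim_mul (c : ℝ) {k : ℝ} (hk : 0 < k) :
    sqrtPrim c (k * c) = c * |c| * sqrtPrim 1 k := by
  have hpos {c : ℝ} (hc : 0 < c) : sqrtPrim c (k * c) = c ^ 2 * sqrtPrim 1 k := by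
    have h1 : √((k * c) ^ 2 + c ^ 2) = c * √(k ^ 2 + 1 ^ 2) := by
      rw [← Real.sqrt_sq hc.le, ← Real.sqrt_mul (sq_nonneg c), Real.sqrt_sq hc.le]
      congr 1
      ring
    have h2 : k * c + c * √(k ^ 2 + 1 ^ 2) = c * (k + √(k ^ 2 + 1 ^ 2)) := by ring
    simp only [sqrtPrim]
    rw [h1, h2, Real.log_mul hc.ne' (by positivity), Real.log_one]
    ring
  have hneg (c u : ℝ) : sqrtPrim (-c) u = sqrtPrim c u := by simp [sqrtPrim]
  rcases lt_trichotomy c 0 with hc | rfl | hc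
  · have := hpos (neg_pos.2 hc)
    rw [hneg, mul_neg, sqrtPrim_neg] at this
    rw [abs_of_neg hc]
    linarith
  · simp [sqrtPrim]
  · rw [hpos hc, abs_of_pos hc]
    ring

end Calculus

section Cost

lemma C_eq (s : ℝ) : C s = 1 / √5 * ((s - 5) * |s - 5| + 25) +
    1 / √2 * ((64 - (s - 2) * |s - 2|) / 2) +
    (sqrtPrim (2 * s / 5 - 2) (3 * s / 10 + 1) -
      (2 * s / 5 - 2) * |2 * s / 5 - 2| * sqrtPrim 1 2) +
    ((s / 2 - 1) * |s / 2 - 1| * sqrtPrim 1 1 + sqrtPrim (s / 2 - 1) 2) := by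
  have h₁ : ∀ t : ℝ, t ^ 2 - (2 * s / 5 + 8) * t + (s ^ 2 / 5 + 20) =
      (t - (s / 5 + 4)) ^ 2 + (2 * s / 5 - 2) ^ 2 := fun t => by ring
  have h₂ : ∀ t : ℝ, t ^ 2 - (s + 14) * t + (s ^ 2 / 2 + 6 * s + 50) =
      (t - (s / 2 + 7)) ^ 2 + (s / 2 - 1) ^ 2 := fun t => by ring
  have e₁ : s / 2 + 5 - (s / 5 + 4) = 3 * s / 10 + 1 := by ring
  have e₂ : s - (s / 5 + 4) = 2 * (2 * s / 5 - 2) := by ring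
  have e₃ : s + 6 - (s / 2 + 7) = 1 * (s / 2 - 1) := by ring
  have e₄ : s / 2 + 5 - (s / 2 + 7) = -2 := by ring
  have e₅ : s + 6 - 8 = s - 2 := by ring
  simp only [C, h₁, h₂, integral_sqrt_sub_sq_add_sq, integral_abs_sub, e₁, e₂, e₃, e₄, e₅,
    sqrtPrim_mul _ two_pos, sqrtPrim_mul _ one_pos, sqrtPrim_neg]
  norm_num
  ring

/-- The derivative of `C`, in terms of `c = 2 s / 5 - 2`, `b = s / 2 - 1`, `U = 3 s / 10 + 1`
and `A = √(s² / 4 - s + 5)`. -/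
noncomputable def costDeriv (c b U A : ℝ) : ℝ :=
  3 / 10 * A + √5 * |c| - √2 * |b| + 2 / 5 * (c * (Real.log (U + A) - Real.log c)) -
    4 / 5 * |c| * ((2 * √5 + Real.log (2 + √5)) / 2) + |b| * ((√2 + Real.log (1 + √2)) / 2) +
    1 / 2 * (b * (Real.log (2 + A) - Real.log b))

lemma hasDerivAt_C {s : ℝ} (hs : 0 ≤ s) : HasDerivAt C
    (costDeriv (2 * s / 5 - 2) (s / 2 - 1) (3 * s / 10 + 1) (√(s ^ 2 / 4 - s + 5))) s := by
  rw [funext C_eq]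
  have hsub (m : ℝ) : HasDerivAt (fun s : ℝ => s - m) 1 s := (hasDerivAt_id s).sub_const m
  have hc : HasDerivAt (fun s : ℝ => 2 * s / 5 - 2) (2 / 5) s :=
    ((((hasDerivAt_id s).const_mul 2).div_const 5).sub_const 2).congr_deriv (by ring)
  have hU : HasDerivAt (fun s : ℝ => 3 * s / 10 + 1) (3 / 10) s :=
    ((((hasDerivAt_id s).const_mul 3).div_const 10).add_const 1).congr_deriv (by ring)
  have hb : HasDerivAt (fun s : ℝ => s / 2 - 1) (1 / 2) s :=
    ((hasDerivAt_id s).div_const 2).sub_const 1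
  have d₁ := ((((hasDerivAt_mul_abs (s - 5)).comp s (hsub 5)).add_const 25).const_mul (1 / √5))
  have d₂ := (((((hasDerivAt_mul_abs (s - 2)).comp s (hsub 2)).const_sub 64).div_const 2).const_mul
    (1 / √2))
  have d₃ := hasDerivAt_sqrtPrim_comp hU hc (Or.inl (by positivity))
  have d₄ := ((hasDerivAt_mul_abs (2 * s / 5 - 2)).comp s hc).mul_const (sqrtPrim 1 2)
  have d₅ := ((hasDerivAt_mul_abs (s / 2 - 1)).comp s hb).mul_const (sqrtPrim 1 1)
  have d₆ := hasDerivAt_sqrtPrim_comp (hasDerivAt_const s 2) hb (Or.inl two_pos)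
  refine (((d₁.add d₂).add (d₃.sub d₄)).add (d₅.add d₆)).congr_deriv ?_
  have hA₁ : (3 * s / 10 + 1) ^ 2 + (2 * s / 5 - 2) ^ 2 = s ^ 2 / 4 - s + 5 := by ring
  have hA₂ : (2 : ℝ) ^ 2 + (s / 2 - 1) ^ 2 = s ^ 2 / 4 - s + 5 := by ring
  have hP₁ : sqrtPrim 1 2 = (2 * √5 + Real.log (2 + √5)) / 2 := by norm_num [sqrtPrim]
  have hP₂ : sqrtPrim 1 1 = (√2 + Real.log (1 + √2)) / 2 := by norm_num [sqrtPrim]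
  have ha : |s - 5| = 5 / 2 * |2 * s / 5 - 2| := by
    rw [show s - 5 = 5 / 2 * (2 * s / 5 - 2) by ring, abs_mul]
    norm_num
  have hb' : |s - 2| = 2 * |s / 2 - 1| := by
    rw [show s - 2 = 2 * (s / 2 - 1) by ring, abs_mul]
    norm_num
  have h5 : 1 / √5 = √5 / 5 := by
    rw [div_eq_div_iff (by positivity) (by norm_num)]
    norm_num
  have h2 : 1 / √2 = √2 / 2 := by
    rw [div_eq_div_iff (by positivity) (by norm_num)]
    norm_num
  simp only [hA₁, hA₂, hP₁, hP₂, ha, hb', h5, h2, costDeriv]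
  ring

lemma deriv_sign_of_minimizer {f : ℝ → ℝ} {f' a b s : ℝ} (hf : HasDerivAt f f' s)
    (hs : s ∈ Set.Icc a b) (hmin : ∀ t ∈ Set.Icc a b, f s ≤ f t) :
    (a < s → f' ≤ 0) ∧ (s < b → 0 ≤ f') := by
  have hslope := hasDerivAt_iff_tendsto_slope.1 hf
  refine ⟨fun ha => ?_, fun hb => ?_⟩
  · refine le_of_tendsto (hslope.mono_left (nhdsWithin_mono s
      (show Set.Iio s ⊆ {s}ᶜ from fun t ht => ht.ne))) ?_
    filter_upwards [Ioo_mem_nhdsLT ha] with t ht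
    rw [slope_def_field]
    exact div_nonpos_of_nonneg_of_nonpos
      (sub_nonneg.2 (hmin t ⟨ht.1.le, ht.2.le.trans hs.2⟩)) (sub_nonpos.2 ht.2.le)
  · refine ge_of_tendsto (hslope.mono_left (nhdsWithin_mono s
      (show Set.Ioi s ⊆ {s}ᶜ from fun t ht => ht.ne'))) ?_
    filter_upwards [Ioo_mem_nhdsGT hb] with t ht
    rw [slope_def_field]
    exact div_nonneg (sub_nonneg.2 (hmin t ⟨hs.1.trans ht.1.le, ht.2.le⟩)) (sub_nonneg.2 ht.1.le)

end Cost

section Sign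

lemma sqrt_five_bounds : 2.236 < √5 ∧ √5 < 2.2361 :=
  ⟨Real.lt_sqrt_of_sq_lt (by norm_num), (Real.sqrt_lt' (by norm_num)).2 (by norm_num)⟩

lemma sqrt_two_bounds : 1.414 < √2 ∧ √2 < 1.4143 :=
  ⟨Real.lt_sqrt_of_sq_lt (by norm_num), (Real.sqrt_lt' (by norm_num)).2 (by norm_num)⟩

lemma three_le_two_mul_log_sub {x y : ℝ} (hx : 0 < x) (hy : 4.5 * x ≤ y) :
    3 ≤ 2 * (Real.log y - Real.log x) := by
  have h : Real.log (x ^ 2 * Real.exp 3) ≤ Real.log (y ^ 2) := by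
    refine Real.log_le_log (by positivity) ?_
    have h3 : Real.exp 3 ≤ 4.5 ^ 2 := by
      have := Real.exp_one_lt_d9
      rw [show (3 : ℝ) = (3 : ℕ) * 1 by norm_num, Real.exp_nat_mul]
      calc Real.exp 1 ^ 3 ≤ 2.7182818286 ^ 3 := by gcongr
        _ ≤ _ := by norm_num
    calc x ^ 2 * Real.exp 3 ≤ x ^ 2 * 4.5 ^ 2 := by gcongr
      _ = (4.5 * x) ^ 2 := by ring
      _ ≤ _ := by gcongr
  rw [Real.log_mul (by positivity) (by positivity), Real.log_exp, Real.log_pow, Real.log_pow] at h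
  push_cast at h
  linarith

lemma costDeriv_pos_of_nonneg {c b U A : ℝ} (hc : 0 ≤ c) (hb : 0 < b) (hb4 : b ≤ 4)
    (hU : 2 * c ≤ U) (hAc : √5 * c ≤ A) (hAb : b ≤ A) : 0 < costDeriv c b U A := by
  obtain ⟨h5, h5'⟩ := sqrt_five_bounds
  obtain ⟨h2, h2'⟩ := sqrt_two_bounds
  have h₁ : c * Real.log (2 + √5) ≤ c * (Real.log (U + A) - Real.log c) := by
    rcases hc.eq_or_lt with rfl | hc
    · simp
    · gcongr
      rw [le_sub_iff_add_le, ← Real.log_mul (by positivity) hc.ne']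
      exact Real.log_le_log (by positivity) (by linarith)
  have h₂ : b * 1 ≤ b * (Real.log (2 + A) + Real.log (1 + √2) - Real.log b) := by
    gcongr
    rw [le_sub_iff_add_le, ← Real.log_mul (by linarith) (by positivity)]
    nth_rewrite 1 [← Real.log_exp 1]
    rw [← Real.log_mul (Real.exp_pos 1).ne' hb.ne']
    refine Real.log_le_log (by positivity) ?_
    have := Real.exp_one_lt_d9
    calc Real.exp 1 * b ≤ 2.8 * b := by gcongr; linarith
      _ ≤ (2 + A) * 2.4 := by linarith
      _ ≤ _ := by gcongr <;> linarith
  have h₃ : b * √2 ≤ b * 1.4143 := by gcongr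
  have h₄ : 0 ≤ √5 * c := by positivity
  rw [costDeriv, abs_of_nonneg hc, abs_of_pos hb]
  linarith

lemma costDeriv_pos_of_nonpos {c b U A : ℝ} (hc : c ≤ 0) (hc' : -2 / 5 ≤ c) (hb : 1 ≤ b)
    (hb' : b ≤ 3 / 2) (hU : 0 < U) (hU' : U ≤ 5 / 2) (hA : 2 ≤ A) (hA' : A ≤ 5 / 2) :
    0 < costDeriv c b U A := by
  obtain ⟨h5, h5'⟩ := sqrt_five_bounds
  obtain ⟨h2, h2'⟩ := sqrt_two_bounds
  obtain ⟨x, rfl⟩ : ∃ x, c = -x := ⟨-c, by ring⟩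
  have hx : 0 ≤ x := by linarith
  have h₁ : x * (Real.log (U + A) + Real.log (2 + √5) - Real.log x) ≤
      (U + A) * (2 + √5) / 54 + 3 * x := by
    rcases hx.eq_or_lt with rfl | hx
    · rw [zero_mul]
      positivity
    · have hpos : 0 < (U + A) * (2 + √5) / x := by positivity
      rw [← Real.log_mul (by positivity) (by positivity), ← Real.log_div (by positivity) hx.ne']
      have h := Real.log_le_sub_one_of_pos (x := (U + A) * (2 + √5) / x / Real.exp 4)
        (by positivity)
      rw [Real.log_div hpos.ne' (by positivity), Real.log_exp] at h
      have h54 : 54 ≤ Real.exp 4 := by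
        have := Real.exp_one_gt_d9
        rw [show (4 : ℝ) = (4 : ℕ) * 1 by norm_num, Real.exp_nat_mul]
        calc (54 : ℝ) ≤ 2.7182818283 ^ 4 := by norm_num
          _ ≤ _ := by gcongr
      have h' : (U + A) * (2 + √5) / x / Real.exp 4 ≤ (U + A) * (2 + √5) / x / 54 := by gcongr
      calc x * Real.log ((U + A) * (2 + √5) / x)
          ≤ x * ((U + A) * (2 + √5) / x / 54 + 3) := by gcongr; linarith
        _ = _ := by field_simp
  have hY : (U + A) * (2 + √5) ≤ (5 / 2 + 5 / 2) * (2 + 2.2361) := by gcongr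
  have h₂ : b * 3 ≤ b * (2 * (Real.log ((2 + A) * (1 + √2)) - Real.log b)) := by
    gcongr
    refine three_le_two_mul_log_sub (by linarith) ?_
    calc 4.5 * b ≤ (2 + 2) * 2.4 := by linarith
      _ ≤ _ := by gcongr; linarith
  rw [Real.log_mul (by linarith) (by positivity)] at h₂
  have h₃ : b * √2 ≤ b * 1.4143 := by gcongr
  have h₄ : 2.236 * x ≤ √5 * x := by gcongr
  rw [costDeriv, abs_neg, Real.log_neg_eq_log, abs_of_nonneg hx, abs_of_pos (by linarith : 0 < b)]
  linarith

lemma costDeriv_zero_neg : costDeriv (-2) (-1) 1 √5 < 0 := by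
  obtain ⟨h5, h5'⟩ := sqrt_five_bounds
  obtain ⟨h2, h2'⟩ := sqrt_two_bounds
  have h₁ := three_le_two_mul_log_sub two_pos (y := (1 + √5) * (2 + √5)) (by nlinarith)
  rw [Real.log_mul (by positivity) (by positivity)] at h₁
  have h₂ : Real.log (1 + √2) ≤ Real.log (2 + √5) := by
    gcongr
    · norm_num
    · norm_num
  rw [costDeriv, Real.log_neg_eq_log, Real.log_neg_eq_log, Real.log_one, abs_neg, abs_neg,
    abs_one, abs_two]
  linarith

end Sign

section Transcendence

lemma IsAlgebraic.real_sqrt {x : ℝ} (h : IsAlgebraic ℚ x) : IsAlgebraic ℚ √x := by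
  rcases le_total 0 x with hx | hx
  · exact IsAlgebraic.of_pow two_pos (by rwa [Real.sq_sqrt hx])
  · rw [Real.sqrt_eq_zero_of_nonpos hx]
    exact isAlgebraic_zero

lemma costDeriv_ne_zero {c b U A : ℝ} (hc : IsAlgebraic ℚ c) (hb : IsAlgebraic ℚ b)
    (hU : IsAlgebraic ℚ U) (hA : IsAlgebraic ℚ A) (hc0 : c < 0) (hb1 : |b| ≤ 1) (hU0 : 0 < U)
    (hA2 : 2 ≤ A) (hcb : -2 / 5 ≥ c) : costDeriv c b U A ≠ 0 := by
  obtain ⟨h5, h5'⟩ := sqrt_five_bounds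
  obtain ⟨h2, h2'⟩ := sqrt_two_bounds
  obtain ⟨x, rfl⟩ : ∃ x, c = -x := ⟨-c, by ring⟩
  have hx0 : 0 < x := by linarith
  have hx : IsAlgebraic ℚ x := by simpa using hc.neg
  have hnat (k : ℕ) : IsAlgebraic ℚ (k : ℝ) := isAlgebraic_natCast k
  have h5A : IsAlgebraic ℚ √5 := by exact_mod_cast (hnat 5).real_sqrt
  have h2A : IsAlgebraic ℚ √2 := by exact_mod_cast (hnat 2).real_sqrt
  have h2A' : IsAlgebraic ℚ (2 : ℝ) := by exact_mod_cast hnat 2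
  have h1A : IsAlgebraic ℚ (1 : ℝ) := isAlgebraic_one
  have hquot (p q : ℕ) : IsAlgebraic ℚ ((p : ℝ) / q) := (hnat p).mul (hnat q).inv
  have habs : IsAlgebraic ℚ |b| := by
    rcases abs_choice b with h | h <;> rw [h]
    exacts [hb, hb.neg]
  obtain ⟨ℓ, hℓ, hbℓ⟩ : ∃ ℓ, IsAlgebraic ℚ (Real.exp ℓ) ∧
      b * ℓ = |b| * Real.log (1 + √2) + b * (Real.log (2 + A) - Real.log b) := by
    have hA0 : 0 < 2 + A := by linarith
    have h2A0 : 0 < 1 + √2 := by positivity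
    rcases lt_trichotomy b 0 with hb0 | rfl | hb0
    · refine ⟨Real.log ((2 + A) / ((1 + √2) * -b)), ?_, ?_⟩
      · have : 0 < (2 + A) / ((1 + √2) * -b) := div_pos hA0 (mul_pos h2A0 (neg_pos.2 hb0))
        rw [Real.exp_log this]
        exact (h2A'.add hA).mul ((h1A.add h2A).mul hb.neg).inv
      · rw [Real.log_div hA0.ne' (mul_pos h2A0 (neg_pos.2 hb0)).ne',
          Real.log_mul h2A0.ne' (neg_pos.2 hb0).ne', Real.log_neg_eq_log, abs_of_neg hb0]
        ring
    · exact ⟨0, by simpa using h1A, by simp⟩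
    · refine ⟨Real.log ((2 + A) * (1 + √2) / b), ?_, ?_⟩
      · rw [Real.exp_log (by positivity)]
        exact ((h2A'.add hA).mul (h1A.add h2A)).mul hb.inv
      · rw [Real.log_div (by positivity) hb0.ne', Real.log_mul hA0.ne' h2A0.ne', abs_of_pos hb0]
        ring
  have hℓ' : IsAlgebraic ℚ (Real.exp (Real.log ((U + A) * (2 + √5) / x))) := by
    rw [Real.exp_log (by positivity)]
    exact ((hU.add hA).mul (h2A'.add h5A)).mul hx.inv
  have hlog : Real.log ((U + A) * (2 + √5) / x) =
      Real.log (U + A) + Real.log (2 + √5) - Real.log x := by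
    rw [Real.log_div (by positivity) hx0.ne', Real.log_mul (by positivity) (by positivity)]
  have hβ₀ : IsAlgebraic ℚ (((3 : ℕ) : ℝ) / (10 : ℕ) * A + ((1 : ℕ) : ℝ) / (5 : ℕ) * (√5 * x) -
      ((1 : ℕ) : ℝ) / (2 : ℕ) * (√2 * |b|)) :=
    (((hquot 3 10).mul hA).add ((hquot 1 5).mul (h5A.mul hx))).sub ((hquot 1 2).mul (h2A.mul habs))
  have hne := add_mul_add_mul_ne_zero hβ₀ (((hquot 2 5).mul hx).neg) ((hquot 1 2).mul hb) hℓ' hℓ ?_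
  · convert hne using 1
    rw [mul_assoc _ b ℓ, hbℓ, hlog, costDeriv, abs_neg, Real.log_neg_eq_log, abs_of_pos hx0]
    push_cast
    ring
  · have h₁ : √2 * |b| ≤ 1.4143 * 1 := by gcongr
    have h₂ : 2.236 * (2 / 5) ≤ √5 * x := by gcongr; linarith
    push_cast
    refine ne_of_gt ?_
    linarith

end Transcendence

/-- `C` attains its minimum on `[0,10]`, and every minimiser is
transcendental over `ℚ`. -/
theorem C_minimizers_transcendental :
    (∃ s ∈ Set.Icc (0 : ℝ) 10, ∀ t ∈ Set.Icc (0 : ℝ) 10, C s ≤ C t) ∧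
    ∀ s ∈ Set.Icc (0 : ℝ) 10,
      (∀ t ∈ Set.Icc (0 : ℝ) 10, C s ≤ C t) → Transcendental ℚ s := by
  refine ⟨isCompact_Icc.exists_isMinOn (Set.nonempty_Icc.2 (by norm_num)) fun s hs =>
    (hasDerivAt_C hs.1).continuousAt.continuousWithinAt, fun s hs hmin halg => ?_⟩
  obtain ⟨hleft, hright⟩ := deriv_sign_of_minimizer (hasDerivAt_C hs.1) hs hmin
  obtain ⟨hs0, hs10⟩ := hs
  have hA2 : 2 ≤ √(s ^ 2 / 4 - s + 5) := Real.le_sqrt_of_sq_le (by nlinarith [sq_nonneg (s - 2)])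
  rcases hs0.eq_or_lt with rfl | hs0
  · refine absurd (hright (by norm_num)) (not_le.2 ?_)
    rw [show (2 * 0 / 5 - 2 : ℝ) = -2 by norm_num, show (0 / 2 - 1 : ℝ) = -1 by norm_num,
      show (3 * 0 / 10 + 1 : ℝ) = 1 by norm_num, show (0 ^ 2 / 4 - 0 + 5 : ℝ) = 5 by norm_num]
    exact costDeriv_zero_neg
  rcases lt_or_ge s 4 with hs4 | hs4
  · have hlin (p q : ℚ) : IsAlgebraic ℚ ((p : ℝ) * s + q) :=
      ((isAlgebraic_algebraMap p).mul halg).add (isAlgebraic_algebraMap q)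
    refine costDeriv_ne_zero ?_ ?_ ?_ ?_ (by linarith) (abs_le.2 ⟨by linarith, by linarith⟩)
      (by linarith) hA2 (by linarith) (le_antisymm (hleft hs0) (hright (by linarith)))
    · convert hlin (2 / 5) (-2) using 1
      push_cast
      ring
    · convert hlin (1 / 2) (-1) using 1
      push_cast
      ring
    · convert hlin (3 / 10) 1 using 1
      push_cast
      ring
    · convert (((hlin (1 / 2) (-1)).pow 2).add (hlin 0 4)).real_sqrt using 2
      push_cast
      ring
  · refine absurd (hleft hs0) (not_le.2 ?_)
    rcases le_total s 5 with hs5 | hs5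
    · refine costDeriv_pos_of_nonpos (by linarith) (by linarith) (by linarith) (by linarith)
        (by linarith) (by linarith) hA2 ((Real.sqrt_le_left (by norm_num)).2 (by nlinarith))
    · refine costDeriv_pos_of_nonneg (by linarith) (by linarith) (by linarith) (by linarith) ?_ ?_
      · rw [← Real.sqrt_sq (by linarith : 0 ≤ 2 * s / 5 - 2), ← Real.sqrt_mul (by norm_num)]
        exact Real.sqrt_le_sqrt (by nlinarith)
      · exact Real.le_sqrt_of_sq_le (by nlinarith)
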